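/- arXiv:2104.11923 — 2 statements merged into one kernel-verified Lean document; each statement's English description precedes it below -/
import Mathlib

section
/- Let C ∈ M_n(ℂ) be a density matrix (positive semidefinite with τ(C) = 1) and let W ∈ H = ⊕_{j∈J} M_n(ℂ). Then, as an identity in [0,∞], sup{ τ(aC) + Re⟨V,W⟩_H : a hermitian in M_n(ℂ), V ∈ H, such that τ(aρ) + ½⟨V, [ρ]_ω V⟩_H ≤ 0 for every density matrix ρ } = ½⟨W, [C]_ω⁻¹ W⟩_H. -/
open MeasureTheory Matrix
open scoped ENNReal Classical ComplexOrder

/-- Normalized trace `τ(A) = Tr(A)/n` on `M_n(ℂ)`. -/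
noncomputable def tau {N : Type*} [Fintype N] (A : Matrix N N ℂ) : ℂ :=
  A.trace / (Fintype.card N)

/-- GNS inner product `⟨A,B⟩ = τ(A* B)`, conjugate-linear in the first argument. -/
noncomputable def gns {N : Type*} [Fintype N] (A B : Matrix N N ℂ) : ℂ := tau (Aᴴ * B)

/-- Fractional power `X^s` of a positive semidefinite matrix via functional calculus
(junk value `0` if `X` is not hermitian). -/
noncomputable def mpow {N : Type*} [Fintype N] [DecidableEq N] (X : Matrix N N ℂ) (s : ℝ) :
    Matrix N N ℂ :=
  if hX : X.IsHermitian then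
    (Matrix.IsHermitian.eigenvectorUnitary hX : Matrix N N ℂ) *
      Matrix.diagonal (fun i => ((hX.eigenvalues i ^ s : ℝ) : ℂ)) *
      (star (Matrix.IsHermitian.eigenvectorUnitary hX : Matrix N N ℂ))
  else 0

/-- The operator `[X]_α(A) = ∫₀¹ e^{α(s-1/2)} X^s A X^{1-s} ds` on `M_n(ℂ)`. -/
noncomputable def sandwich {N : Type*} [Fintype N] [DecidableEq N] (X : Matrix N N ℂ) (α : ℝ)
    (A : Matrix N N ℂ) : Matrix N N ℂ :=
  Matrix.of fun i k =>
    ∫ s in (0:ℝ)..1, Real.exp (α * (s - 1/2)) • ((mpow X s * A * mpow X (1 - s)) i k)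

section H

variable {N : Type*} [Fintype N] [DecidableEq N] {J : Type*} [Fintype J]

/-- Inner product on `H = ⊕_{j ∈ J} M_n(ℂ)`. -/
noncomputable def gnsH (V W : J → Matrix N N ℂ) : ℂ := ∑ j, gns (V j) (W j)

/-- The operator `[ρ]_ω = ⊕_j [ρ]_{ω_j}` on `H`. -/
noncomputable def opOmega (ω : J → ℝ) (ρ : Matrix N N ℂ) (W : J → Matrix N N ℂ) :
    J → Matrix N N ℂ :=
  fun j => sandwich ρ (ω j) (W j)

/-- Extended value `⟨V, K⁻¹ V⟩ ∈ [0,∞]`: equals `⟨W, K W⟩` if `V = K W` with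
`W ⊥ ker K`, and `∞` if `V ∉ ran K`. -/
noncomputable def invQuadH (K : (J → Matrix N N ℂ) → (J → Matrix N N ℂ))
    (V : J → Matrix N N ℂ) : ℝ≥0∞ :=
  if h : ∃ W, K W = V ∧ ∀ U, K U = 0 → gnsH W U = 0
  then ENNReal.ofReal (gnsH h.choose (K h.choose)).re
  else ⊤

/-- The partial derivative `∂_j A = [V_j, A]`; `gradD V A = ∇A`. -/
noncomputable def gradD (Vf : J → Matrix N N ℂ) (A : Matrix N N ℂ) : J → Matrix N N ℂ :=
  fun j => Vf j * A - A * Vf j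

/-- The Lindblad generator `L(A) = ∑_j (e^{-ω_j/2} V_j^*[A,V_j] - e^{ω_j/2}[A,V_j]V_j^*)`. -/
noncomputable def genL (Vf : J → Matrix N N ℂ) (ω : J → ℝ) (A : Matrix N N ℂ) :
    Matrix N N ℂ :=
  ∑ j, (Real.exp (-ω j / 2) • ((Vf j)ᴴ * (A * Vf j - Vf j * A)) -
        Real.exp (ω j / 2) • ((A * Vf j - Vf j * A) * (Vf j)ᴴ))

/-- Membership in `CE_ε(ρ₀,ρ₁)`: `ρ` is a C¹ curve of invertible density matrices joining
`ρ₀` to `ρ₁`, `Vc` is continuous, and the continuity equation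
`ρ'(t) + div Vc(t) = ε L†ρ(t)` holds on `[0,1]`. -/
def IsCE (dvg : (J → Matrix N N ℂ) → Matrix N N ℂ) (Ldag : Matrix N N ℂ → Matrix N N ℂ)
    (ε : ℝ) (ρ₀ ρ₁ : Matrix N N ℂ) (ρ : ℝ → Matrix N N ℂ) (Vc : ℝ → J → Matrix N N ℂ) :
    Prop :=
  ρ 0 = ρ₀ ∧ ρ 1 = ρ₁ ∧
  (∀ t ∈ Set.Icc (0:ℝ) 1, (ρ t).PosDef ∧ tau (ρ t) = 1) ∧
  (∀ j i k, ContinuousOn (fun t => Vc t j i k) (Set.Icc (0:ℝ) 1)) ∧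
  ∃ ρ' : ℝ → Matrix N N ℂ,
    (∀ t ∈ Set.Icc (0:ℝ) 1, ∀ i k, HasDerivAt (fun s => ρ s i k) (ρ' t i k) t) ∧
    (∀ i k, ContinuousOn (fun t => ρ' t i k) (Set.Icc (0:ℝ) 1)) ∧
    (∀ t ∈ Set.Icc (0:ℝ) 1, ρ' t + dvg (Vc t) = ε • Ldag (ρ t))

/-- The squared entropic transport distance `W_ε²(ρ₀,ρ₁)`. -/
noncomputable def Wsq (ω : J → ℝ) (dvg : (J → Matrix N N ℂ) → Matrix N N ℂ)
    (Ldag : Matrix N N ℂ → Matrix N N ℂ) (ε : ℝ) (ρ₀ ρ₁ : Matrix N N ℂ) : ℝ≥0∞ :=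
  ⨅ (ρ : ℝ → Matrix N N ℂ) (Vc : ℝ → J → Matrix N N ℂ)
    (_ : IsCE dvg Ldag ε ρ₀ ρ₁ ρ Vc),
      ∫⁻ t in Set.Icc (0:ℝ) 1, invQuadH (opOmega ω (ρ t)) (Vc t)

/-- Hamilton–Jacobi–Bellmann subsolutions: `A` is a C¹ curve of hermitian matrices with
`τ((Ȧ(t) + ε L A(t))ρ) + ½⟨∇A(t), [ρ]_ω ∇A(t)⟩ ≤ 0` for all `t ∈ [0,1]` and all
density matrices `ρ`.  (`A'` records the derivative of `A`.) -/
noncomputable def IsHJB (Vf : J → Matrix N N ℂ) (ω : J → ℝ) (ε : ℝ)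
    (A A' : ℝ → Matrix N N ℂ) : Prop :=
  (∀ t ∈ Set.Icc (0:ℝ) 1, (A t).IsHermitian) ∧
  (∀ t ∈ Set.Icc (0:ℝ) 1, ∀ i k, HasDerivAt (fun s => A s i k) (A' t i k) t) ∧
  (∀ i k, ContinuousOn (fun t => A' t i k) (Set.Icc (0:ℝ) 1)) ∧
  ∀ t ∈ Set.Icc (0:ℝ) 1, ∀ ρ : Matrix N N ℂ, ρ.PosSemidef → tau ρ = 1 →
    (tau ((A' t + ε • genL Vf ω (A t)) * ρ)).re
      + (1/2) * (gnsH (gradD Vf (A t)) (opOmega ω ρ (gradD Vf (A t)))).re ≤ 0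

end H

/-- The weighted logarithmic mean `∫₀¹ e^{α(s-1/2)} x^s y^{1-s} ds`. -/
noncomputable def logMean (α x y : ℝ) : ℝ :=
  ∫ s in (0:ℝ)..1, Real.exp (α * (s - 1/2)) * (x ^ s * y ^ (1 - s))

/-- The segment `θ e^{α/2} x + (1-θ) e^{-α/2} y` whose inverses average to `1 / logMean α x y`. -/
noncomputable def tiltSeg (α x y θ : ℝ) : ℝ :=
  θ * (Real.exp (α / 2) * x) + (1 - θ) * (Real.exp (-(α / 2)) * y)

lemma rpow_mul_rpow_ae_eq_zero {x y : ℝ} (h : x = 0 ∨ y = 0) :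
    (fun s : ℝ => x ^ s * y ^ (1 - s)) =ᵐ[volume] fun _ => 0 := by
  have h0 : ∀ᵐ s : ℝ ∂volume, s ≠ 0 := by simp [ae_iff]
  have h1 : ∀ᵐ s : ℝ ∂volume, s ≠ 1 := by simp [ae_iff]
  filter_upwards [h0, h1] with s hs0 hs1
  rcases h with rfl | rfl
  · simp [Real.zero_rpow hs0]
  · simp [Real.zero_rpow (sub_ne_zero.2 hs1.symm)]

lemma intervalIntegrable_rpow_mul_rpow (α : ℝ) {x y : ℝ} (hx : 0 ≤ x) (hy : 0 ≤ y) (a b : ℝ) :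
    IntervalIntegrable (fun s => Real.exp (α * (s - 1/2)) * (x ^ s * y ^ (1 - s)))
      volume a b := by
  by_cases h : x = 0 ∨ y = 0
  · have h' : (fun _ : ℝ => (0 : ℝ)) =ᵐ[volume]
        fun s : ℝ => Real.exp (α * (s - 1/2)) * (x ^ s * y ^ (1 - s)) := by
      filter_upwards [rpow_mul_rpow_ae_eq_zero h] with s hs
      rw [hs, mul_zero]
    exact (intervalIntegrable_const (c := (0 : ℝ))).congr_ae (ae_restrict_of_ae h')
  · push Not at h
    have hx' : 0 < x := lt_of_le_of_ne hx h.1.symm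
    have hy' : 0 < y := lt_of_le_of_ne hy h.2.symm
    apply Continuous.intervalIntegrable
    have h1 : Continuous fun s : ℝ => x ^ s := Real.continuous_const_rpow hx'.ne'
    have h2 : Continuous fun s : ℝ => y ^ (1 - s) :=
      (Real.continuous_const_rpow hy'.ne').comp (by fun_prop)
    fun_prop

lemma logMean_eq_zero (α : ℝ) {x y : ℝ} (h : x = 0 ∨ y = 0) : logMean α x y = 0 := by
  have h' : (fun s : ℝ => Real.exp (α * (s - 1/2)) * (x ^ s * y ^ (1 - s)))
      =ᵐ[volume] fun _ => 0 := by
    filter_upwards [rpow_mul_rpow_ae_eq_zero h] with s hs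
    rw [hs, mul_zero]
  unfold logMean
  rw [intervalIntegral.integral_congr_ae (g := fun _ => 0) (h'.mono fun s hs _ => hs)]
  simp

lemma logMean_nonneg (α : ℝ) {x y : ℝ} (hx : 0 ≤ x) (hy : 0 ≤ y) : 0 ≤ logMean α x y :=
  intervalIntegral.integral_nonneg zero_le_one fun s _ => by positivity

lemma continuous_tiltSeg (α x y : ℝ) : Continuous (tiltSeg α x y) := by
  unfold tiltSeg; fun_prop

lemma tiltSeg_nonneg (α : ℝ) {x y θ : ℝ} (hx : 0 ≤ x) (hy : 0 ≤ y)
    (hθ : θ ∈ Set.Icc (0:ℝ) 1) : 0 ≤ tiltSeg α x y θ := by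
  have := hθ.1
  have := sub_nonneg.2 hθ.2
  unfold tiltSeg; positivity

lemma segment_pos {u w θ : ℝ} (hu : 0 < u) (hw : 0 < w) (hθ : θ ∈ Set.Icc (0:ℝ) 1) :
    0 < θ * u + (1 - θ) * w := by
  rcases hθ.1.eq_or_lt with h | h
  · rw [← h]; simpa using hw
  · have := mul_nonneg (sub_nonneg.2 hθ.2) hw.le
    have := mul_pos h hu
    linarith

lemma tiltSeg_pos (α : ℝ) {x y θ : ℝ} (hx : 0 < x) (hy : 0 < y)
    (hθ : θ ∈ Set.Icc (0:ℝ) 1) : 0 < tiltSeg α x y θ :=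
  segment_pos (by positivity) (by positivity) hθ

lemma integral_inv_segment_mul_integral_rpow {u w : ℝ} (hu : 0 < u) (hw : 0 < w) :
    (∫ θ in (0:ℝ)..1, (θ * u + (1 - θ) * w)⁻¹) * (∫ s in (0:ℝ)..1, u ^ s * w ^ (1 - s)) = 1 := by
  have hpos : ∀ θ ∈ Set.uIcc (0:ℝ) 1, 0 < θ * u + (1 - θ) * w := fun θ hθ =>
    segment_pos hu hw (by rwa [Set.uIcc_of_le zero_le_one] at hθ)
  have hexp : ∀ s : ℝ, u ^ s * w ^ (1 - s)
      = Real.exp (s * (Real.log u - Real.log w) + Real.log w) := fun s => by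
    rw [Real.rpow_def_of_pos hu, Real.rpow_def_of_pos hw, ← Real.exp_add]
    ring_nf
  by_cases huw : u = w
  · subst huw
    have h1 : ∀ θ : ℝ, θ * u + (1 - θ) * u = u := fun θ => by ring
    simp only [h1, hexp]
    simp [Real.exp_log hu, hu.ne']
  · have hd : Real.log u - Real.log w ≠ 0 := fun h =>
      huw (Real.log_injOn_pos hu hw (sub_eq_zero.1 h))
    have hd' : u - w ≠ 0 := sub_ne_zero.2 huw
    have hcont : ContinuousOn (fun θ : ℝ => (θ * u + (1 - θ) * w)⁻¹) (Set.uIcc 0 1) :=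
      ContinuousOn.inv₀ (by fun_prop) fun θ hθ => (hpos θ hθ).ne'
    have h1 : (∫ θ in (0:ℝ)..1, (θ * u + (1 - θ) * w)⁻¹)
        = (Real.log u - Real.log w) / (u - w) := by
      rw [intervalIntegral.integral_eq_sub_of_hasDerivAt
        (f := fun θ => Real.log (θ * u + (1 - θ) * w) / (u - w)) (fun θ hθ => ?_)
        hcont.intervalIntegrable]
      · simp [sub_div]
      · have hlin : HasDerivAt (fun θ : ℝ => θ * u + (1 - θ) * w) (u - w) θ := by
          have := ((hasDerivAt_id θ).mul_const u).add
            (((hasDerivAt_id θ).const_sub 1).mul_const w)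
          exact this.congr_deriv (by ring)
        have := (hlin.log (hpos θ hθ).ne').div_const (u - w)
        refine this.congr_deriv ?_
        field_simp
    have h2 : (∫ s in (0:ℝ)..1, u ^ s * w ^ (1 - s))
        = (u - w) / (Real.log u - Real.log w) := by
      simp only [hexp]
      rw [intervalIntegral.integral_eq_sub_of_hasDerivAt
        (f := fun s => Real.exp (s * (Real.log u - Real.log w) + Real.log w) /
          (Real.log u - Real.log w)) (fun s _ => ?_)
        (by apply Continuous.intervalIntegrable; fun_prop)]
      · simp [sub_div, Real.exp_log hu, Real.exp_log hw]
      · have hlin : HasDerivAt (fun s : ℝ => s * (Real.log u - Real.log w) + Real.log w)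
            (Real.log u - Real.log w) s := by
          simpa using ((hasDerivAt_id s).mul_const (Real.log u - Real.log w)).add_const
            (Real.log w)
        have := hlin.exp.div_const (Real.log u - Real.log w)
        refine this.congr_deriv ?_
        field_simp
    rw [h1, h2]
    field_simp

lemma integral_inv_tiltSeg_mul_logMean (α : ℝ) {x y : ℝ} (hx : 0 < x) (hy : 0 < y) :
    (∫ θ in (0:ℝ)..1, (tiltSeg α x y θ)⁻¹) * logMean α x y = 1 := by
  have h := integral_inv_segment_mul_integral_rpow (u := Real.exp (α / 2) * x)
    (w := Real.exp (-(α / 2)) * y) (by positivity) (by positivity)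
  have h2 : ∀ s : ℝ, Real.exp (α * (s - 1/2)) * (x ^ s * y ^ (1 - s))
      = (Real.exp (α / 2) * x) ^ s * (Real.exp (-(α / 2)) * y) ^ (1 - s) := fun s => by
    rw [Real.mul_rpow (Real.exp_pos _).le hx.le, Real.mul_rpow (Real.exp_pos _).le hy.le,
      ← Real.exp_mul, ← Real.exp_mul,
      show α * (s - 1/2) = α / 2 * s + -(α / 2) * (1 - s) by ring, Real.exp_add]
    ring
  simpa only [logMean, tiltSeg, h2] using h

lemma logMean_pos (α : ℝ) {x y : ℝ} (hx : 0 < x) (hy : 0 < y) : 0 < logMean α x y := by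
  refine lt_of_le_of_ne (logMean_nonneg α hx.le hy.le) fun h => ?_
  have := integral_inv_tiltSeg_mul_logMean α hx hy
  rw [← h, mul_zero] at this
  exact zero_ne_one this

lemma integral_inv_tiltSeg (α : ℝ) {x y : ℝ} (hx : 0 < x) (hy : 0 < y) :
    (∫ θ in (0:ℝ)..1, (tiltSeg α x y θ)⁻¹) = (logMean α x y)⁻¹ :=
  eq_inv_of_mul_eq_one_left (integral_inv_tiltSeg_mul_logMean α hx hy)

lemma continuousOn_inv_tiltSeg (α : ℝ) {x y : ℝ} (hx : 0 < x) (hy : 0 < y) :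
    ContinuousOn (fun θ => (tiltSeg α x y θ)⁻¹) (Set.Icc 0 1) :=
  (continuous_tiltSeg α x y).continuousOn.inv₀ fun _ hθ => (tiltSeg_pos α hx hy hθ).ne'

lemma ContinuousOn.intervalIntegrable_zero_one {E : Type*} [NormedAddCommGroup E] {f : ℝ → E}
    (hf : ContinuousOn f (Set.Icc 0 1)) : IntervalIntegrable f volume 0 1 :=
  ContinuousOn.intervalIntegrable (by rwa [Set.uIcc_of_le zero_le_one])

/-- Cauchy–Schwarz bound: the logarithmic mean is dominated by the segment `tiltSeg` along any
decomposition `∫₀¹ v θ dθ`. -/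
lemma logMean_mul_normSq_integral_le (α : ℝ) {x y : ℝ} (hx : 0 ≤ x) (hy : 0 ≤ y) {v : ℝ → ℂ}
    (hv : ContinuousOn v (Set.Icc 0 1)) :
    logMean α x y * ‖∫ θ in (0:ℝ)..1, v θ‖ ^ 2
      ≤ ∫ θ in (0:ℝ)..1, tiltSeg α x y θ * ‖v θ‖ ^ 2 := by
  by_cases h : x = 0 ∨ y = 0
  · rw [logMean_eq_zero α h, zero_mul]
    exact intervalIntegral.integral_nonneg zero_le_one fun θ hθ =>
      mul_nonneg (tiltSeg_nonneg α hx hy hθ) (sq_nonneg _)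
  push Not at h
  have hx' : 0 < x := lt_of_le_of_ne hx h.1.symm
  have hy' : 0 < y := lt_of_le_of_ne hy h.2.symm
  have hL := logMean_pos α hx' hy'
  set m := ∫ θ in (0:ℝ)..1, ‖v θ‖ with hm
  have hle : ‖∫ θ in (0:ℝ)..1, v θ‖ ≤ m :=
    intervalIntegral.norm_integral_le_integral_norm zero_le_one
  set c := logMean α x y * m with hc
  have hint1 : IntervalIntegrable (fun θ => 2 * c * ‖v θ‖) volume 0 1 :=
    (continuousOn_const.mul hv.norm).intervalIntegrable_zero_one
  have hint2 : IntervalIntegrable (fun θ => c ^ 2 * (tiltSeg α x y θ)⁻¹) volume 0 1 :=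
    (continuousOn_const.mul (continuousOn_inv_tiltSeg α hx' hy')).intervalIntegrable_zero_one
  have hint3 : IntervalIntegrable (fun θ => tiltSeg α x y θ * ‖v θ‖ ^ 2) volume 0 1 :=
    ((continuous_tiltSeg α x y).continuousOn.mul (hv.norm.pow 2)).intervalIntegrable_zero_one
  have hmono := intervalIntegral.integral_mono_on zero_le_one (hint1.sub hint2) hint3
    fun θ hθ => by
      have hA := tiltSeg_pos α hx' hy' hθ
      have : tiltSeg α x y θ * ‖v θ‖ ^ 2 - (2 * c * ‖v θ‖ - c ^ 2 * (tiltSeg α x y θ)⁻¹)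
          = tiltSeg α x y θ * (‖v θ‖ - c * (tiltSeg α x y θ)⁻¹) ^ 2 := by
        field_simp; ring
      have : 0 ≤ tiltSeg α x y θ * (‖v θ‖ - c * (tiltSeg α x y θ)⁻¹) ^ 2 := by positivity
      linarith
  rw [intervalIntegral.integral_sub hint1 hint2, intervalIntegral.integral_const_mul,
    intervalIntegral.integral_const_mul, integral_inv_tiltSeg α hx' hy', ← hm] at hmono
  have hval : 2 * c * m - c ^ 2 * (logMean α x y)⁻¹ = logMean α x y * m ^ 2 := by
    rw [hc]; field_simp; ring
  rw [hval] at hmono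
  refine le_trans ?_ hmono
  gcongr

/-- The averaged inverse of a regularized degenerate segment is unbounded. -/
lemma exists_integral_inv_tiltSeg_add_ge (α : ℝ) {x y : ℝ} (hx : 0 ≤ x) (hy : 0 ≤ y)
    (h : x = 0 ∨ y = 0) (T : ℝ) :
    ∃ ε > 0, T ≤ ∫ θ in (0:ℝ)..1, (tiltSeg α x y θ + ε)⁻¹ := by
  have key : ∀ M : ℝ, 0 < M → ∃ ε > 0, T ≤ ∫ θ in (0:ℝ)..1, (M * θ + ε)⁻¹ := fun M hM => by
    refine ⟨M * Real.exp (-(M * T)), by positivity, ?_⟩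
    set ε := M * Real.exp (-(M * T)) with hε
    have hε0 : 0 < ε := by positivity
    have hpos : ∀ θ ∈ Set.uIcc (0:ℝ) 1, 0 < M * θ + ε := fun θ hθ => by
      rw [Set.uIcc_of_le zero_le_one] at hθ
      have := mul_nonneg hM.le hθ.1
      linarith
    have hcont : ContinuousOn (fun θ : ℝ => (M * θ + ε)⁻¹) (Set.uIcc 0 1) :=
      ContinuousOn.inv₀ (by fun_prop) fun θ hθ => (hpos θ hθ).ne'
    rw [intervalIntegral.integral_eq_sub_of_hasDerivAt
      (f := fun θ => Real.log (M * θ + ε) / M) (fun θ hθ => ?_) hcont.intervalIntegrable]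
    · have h1 : Real.log M ≤ Real.log (M * 1 + ε) := Real.log_le_log hM (by linarith)
      have h2 : Real.log (M * 0 + ε) = Real.log M - M * T := by
        rw [mul_zero, zero_add, hε, Real.log_mul hM.ne' (Real.exp_pos _).ne', Real.log_exp]
        ring
      rw [← sub_div, le_div_iff₀ hM, h2]
      linarith
    · have hlin : HasDerivAt (fun θ : ℝ => M * θ + ε) M θ := by
        simpa using ((hasDerivAt_id θ).const_mul M).add_const ε
      have := (hlin.log (hpos θ hθ).ne').div_const M
      refine this.congr_deriv ?_
      field_simp
  have mono : ∀ (M ε : ℝ) (f : ℝ → ℝ), 0 < ε → Continuous f →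
      (∀ θ ∈ Set.Icc (0:ℝ) 1, 0 ≤ f θ ∧ f θ ≤ M * θ) →
      ∫ θ in (0:ℝ)..1, (M * θ + ε)⁻¹ ≤ ∫ θ in (0:ℝ)..1, (f θ + ε)⁻¹ := by
    intro M ε f hε hf hfM
    have hp : ∀ θ ∈ Set.Icc (0:ℝ) 1, 0 < f θ + ε := fun θ hθ => by linarith [(hfM θ hθ).1]
    have hp' : ∀ θ ∈ Set.Icc (0:ℝ) 1, 0 < M * θ + ε := fun θ hθ => by
      linarith [(hfM θ hθ).1, (hfM θ hθ).2]
    refine intervalIntegral.integral_mono_on zero_le_one ?_ ?_ fun θ hθ => ?_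
    · exact ContinuousOn.intervalIntegrable_zero_one
        (ContinuousOn.inv₀ (by fun_prop) fun θ hθ => (hp' θ hθ).ne')
    · exact ContinuousOn.intervalIntegrable_zero_one
        (ContinuousOn.inv₀ (by fun_prop) fun θ hθ => (hp θ hθ).ne')
    · exact inv_anti₀ (hp θ hθ) (by linarith [(hfM θ hθ).2])
  rcases h with rfl | rfl
  · obtain ⟨ε, hε, hT⟩ := key (Real.exp (-(α / 2)) * y + 1) (by positivity)
    refine ⟨ε, hε, hT.trans ?_⟩
    have hrefl : (∫ θ in (0:ℝ)..1, (tiltSeg α 0 y θ + ε)⁻¹)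
        = ∫ θ in (0:ℝ)..1, (tiltSeg α 0 y (1 - θ) + ε)⁻¹ := by
      simpa using (intervalIntegral.integral_comp_sub_left (a := 0) (b := 1)
        (fun θ => (tiltSeg α 0 y θ + ε)⁻¹) 1).symm
    rw [hrefl]
    refine mono _ ε (fun θ => tiltSeg α 0 y (1 - θ)) hε
      ((continuous_tiltSeg α 0 y).comp (by fun_prop)) fun θ hθ => ?_
    refine ⟨tiltSeg_nonneg α le_rfl hy ⟨by linarith [hθ.2], by linarith [hθ.1]⟩, ?_⟩
    unfold tiltSeg
    nlinarith [hθ.1]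
  · obtain ⟨ε, hε, hT⟩ := key (Real.exp (α / 2) * x + 1) (by positivity)
    refine ⟨ε, hε, hT.trans ?_⟩
    refine mono _ ε (tiltSeg α x 0) hε (continuous_tiltSeg α x 0) fun θ hθ => ?_
    refine ⟨tiltSeg_nonneg α hx le_rfl hθ, ?_⟩
    unfold tiltSeg
    nlinarith [hθ.1]

lemma intervalIntegrable_finsetSum {ι E : Type*} [NormedAddCommGroup E] (t : Finset ι)
    {f : ι → ℝ → E} {a b : ℝ} (h : ∀ i ∈ t, IntervalIntegrable (f i) volume a b) :
    IntervalIntegrable (fun x => ∑ i ∈ t, f i x) volume a b := by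
  simpa only [Finset.sum_fn] using IntervalIntegrable.sum t h

lemma intervalIntegrable_entry {N : Type*} {X : ℝ → Matrix N N ℂ} (hX : ContinuousOn X (Set.Icc 0 1))
    (i k : N) : IntervalIntegrable (fun θ => X θ i k) volume 0 1 :=
  ContinuousOn.intervalIntegrable_zero_one
    ((continuous_apply_apply i k).comp_continuousOn hX)

/-- Entrywise integral over `[0,1]` of a matrix-valued curve. -/
noncomputable def entryIntegral {N : Type*} (X : ℝ → Matrix N N ℂ) : Matrix N N ℂ :=
  Matrix.of fun i k => ∫ θ in (0:ℝ)..1, X θ i k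

/-- The hermitian matrix representing
`ρ ↦ -½ ∑ⱼ ∫₀¹ ⟨Xⱼ(θ), (θ e^{ωⱼ/2} L_ρ + (1-θ) e^{-ωⱼ/2} R_ρ) Xⱼ(θ)⟩ dθ`. -/
noncomputable def dualWeight {N : Type*} [Fintype N] {J : Type*} [Fintype J] (ω : J → ℝ)
    (X : J → ℝ → Matrix N N ℂ) : Matrix N N ℂ :=
  (-(1/2) : ℂ) • entryIntegral fun θ => ∑ j,
    (((θ * Real.exp (ω j / 2) : ℝ) : ℂ) • (X j θ * (X j θ)ᴴ)
      + (((1 - θ) * Real.exp (-(ω j / 2)) : ℝ) : ℂ) • ((X j θ)ᴴ * X j θ))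

lemma dualWeight_isHermitian {N : Type*} [Fintype N] {J : Type*} [Fintype J] (ω : J → ℝ)
    (X : J → ℝ → Matrix N N ℂ) : (dualWeight ω X).IsHermitian := by
  have h : ∀ F : ℝ → Matrix N N ℂ, (∀ θ, (F θ).IsHermitian) →
      (entryIntegral F).IsHermitian := fun F hF => by
    ext i k
    simp only [Matrix.conjTranspose_apply, entryIntegral, Matrix.of_apply]
    simp only [← (hF _).apply i k]
    rw [intervalIntegral.integral_of_le zero_le_one, intervalIntegral.integral_of_le zero_le_one]
    exact integral_conj.symm
  unfold dualWeight
  refine (h _ fun θ => ?_).smul (by simp [IsSelfAdjoint])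
  refine isSelfAdjoint_sum _ fun j _ => ?_
  exact ((Matrix.isHermitian_mul_conjTranspose_self _).smul (Complex.conj_ofReal _)).add
    ((Matrix.isHermitian_conjTranspose_mul_self _).smul (Complex.conj_ofReal _))

section MatrixTools

variable {N : Type*} [Fintype N] [DecidableEq N] {J : Type*} [Fintype J]

lemma linearMap_entryIntegral (L : Matrix N N ℂ →ₗ[ℂ] ℂ) {X : ℝ → Matrix N N ℂ}
    (hX : ∀ i k, IntervalIntegrable (fun θ => X θ i k) volume 0 1) :
    L (entryIntegral X) = ∫ θ in (0:ℝ)..1, L (X θ) := by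
  have hL : ∀ M : Matrix N N ℂ, L M = ∑ i, ∑ k, M i k * L (Matrix.single i k 1) := fun M => by
    conv_lhs => rw [Matrix.matrix_eq_sum_single M]
    simp only [map_sum]
    refine Finset.sum_congr rfl fun i _ => Finset.sum_congr rfl fun k _ => ?_
    rw [← smul_eq_mul, ← map_smul, Matrix.smul_single, smul_eq_mul, mul_one]
  rw [hL]
  simp only [fun θ => hL (X θ)]
  rw [intervalIntegral.integral_finsetSum
    fun i _ => intervalIntegrable_finsetSum _ fun k _ => (hX i k).mul_const _]
  refine Finset.sum_congr rfl fun i _ => ?_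
  rw [intervalIntegral.integral_finsetSum fun k _ => (hX i k).mul_const _]
  refine Finset.sum_congr rfl fun k _ => ?_
  rw [intervalIntegral.integral_mul_const]
  rfl

/-- `U* X U`, the matrix of `X` in the eigenbasis of the hermitian matrix `ρ`. -/
noncomputable def toEigenbasis {ρ : Matrix N N ℂ} (hρ : ρ.IsHermitian) :
    Matrix N N ℂ →ₗ[ℂ] Matrix N N ℂ where
  toFun X := star (hρ.eigenvectorUnitary : Matrix N N ℂ) * X * hρ.eigenvectorUnitary
  map_add' X Y := by rw [mul_add, add_mul]
  map_smul' c X := by simp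

/-- `U X U*`, the inverse of `toEigenbasis`. -/
noncomputable def ofEigenbasis {ρ : Matrix N N ℂ} (hρ : ρ.IsHermitian) (X : Matrix N N ℂ) :
    Matrix N N ℂ :=
  hρ.eigenvectorUnitary * X * star (hρ.eigenvectorUnitary : Matrix N N ℂ)

variable {ρ : Matrix N N ℂ} (hρ : ρ.IsHermitian)

lemma toEigenbasis_apply (X : Matrix N N ℂ) : toEigenbasis hρ X =
    star (hρ.eigenvectorUnitary : Matrix N N ℂ) * X * hρ.eigenvectorUnitary := rfl

lemma star_eigenvectorUnitary_mul : star (hρ.eigenvectorUnitary : Matrix N N ℂ) *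
    hρ.eigenvectorUnitary = 1 := Unitary.coe_star_mul_self _

lemma eigenvectorUnitary_mul_star : (hρ.eigenvectorUnitary : Matrix N N ℂ) *
    star (hρ.eigenvectorUnitary : Matrix N N ℂ) = 1 := Unitary.coe_mul_star_self _

lemma toEigenbasis_ofEigenbasis (X : Matrix N N ℂ) :
    toEigenbasis hρ (ofEigenbasis hρ X) = X := by
  simp only [toEigenbasis_apply, ofEigenbasis]
  rw [← mul_assoc, ← mul_assoc, star_eigenvectorUnitary_mul, one_mul, mul_assoc,
    star_eigenvectorUnitary_mul, mul_one]

lemma ofEigenbasis_toEigenbasis (X : Matrix N N ℂ) :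
    ofEigenbasis hρ (toEigenbasis hρ X) = X := by
  simp only [toEigenbasis_apply, ofEigenbasis]
  rw [← mul_assoc, ← mul_assoc, eigenvectorUnitary_mul_star, one_mul, mul_assoc,
    eigenvectorUnitary_mul_star, mul_one]

lemma toEigenbasis_injective : Function.Injective (toEigenbasis hρ) :=
  Function.LeftInverse.injective (ofEigenbasis_toEigenbasis hρ)

lemma toEigenbasis_mul (X Y : Matrix N N ℂ) :
    toEigenbasis hρ (X * Y) = toEigenbasis hρ X * toEigenbasis hρ Y := by
  simp only [toEigenbasis_apply]
  rw [mul_assoc, mul_assoc, mul_assoc, mul_assoc, mul_assoc,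
    ← mul_assoc (hρ.eigenvectorUnitary : Matrix N N ℂ), eigenvectorUnitary_mul_star, one_mul]

lemma toEigenbasis_conjTranspose (X : Matrix N N ℂ) :
    toEigenbasis hρ Xᴴ = (toEigenbasis hρ X)ᴴ := by
  simp only [toEigenbasis_apply, Matrix.conjTranspose_mul, Matrix.star_eq_conjTranspose,
    Matrix.conjTranspose_conjTranspose, mul_assoc]

lemma trace_toEigenbasis (X : Matrix N N ℂ) : (toEigenbasis hρ X).trace = X.trace := by
  rw [toEigenbasis_apply, Matrix.trace_mul_comm, ← mul_assoc, eigenvectorUnitary_mul_star,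
    one_mul]

lemma toEigenbasis_self :
    toEigenbasis hρ ρ = Matrix.diagonal (fun i => ((hρ.eigenvalues i : ℝ) : ℂ)) := by
  have h := hρ.spectral_theorem
  rw [Unitary.conjStarAlgAut_apply] at h
  exact (congrArg (toEigenbasis hρ) h).trans (toEigenbasis_ofEigenbasis hρ _)

lemma continuous_toEigenbasis : Continuous (toEigenbasis hρ) :=
  (continuous_const.mul continuous_id).mul continuous_const

lemma continuous_ofEigenbasis : Continuous (ofEigenbasis hρ) :=
  (continuous_const.mul continuous_id).mul continuous_const

lemma toEigenbasis_entryIntegral_apply {X : ℝ → Matrix N N ℂ}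
    (hX : ∀ i k, IntervalIntegrable (fun θ => X θ i k) volume 0 1) (k l : N) :
    toEigenbasis hρ (entryIntegral X) k l = ∫ θ in (0:ℝ)..1, toEigenbasis hρ (X θ) k l :=
  linearMap_entryIntegral ((Matrix.entryLinearMap ℂ ℂ k l).comp (toEigenbasis hρ)) hX

lemma gns_eq_sum (A B : Matrix N N ℂ) :
    gns A B = (∑ k, ∑ l, star (toEigenbasis hρ A k l) * toEigenbasis hρ B k l)
      / Fintype.card N := by
  rw [gns, tau, ← trace_toEigenbasis hρ, toEigenbasis_mul, toEigenbasis_conjTranspose,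
    Finset.sum_comm]
  simp [Matrix.trace, Matrix.mul_apply]

lemma tau_mul_conjTranspose_mul (X : Matrix N N ℂ) :
    tau (X * Xᴴ * ρ) = ((∑ k, ∑ l, hρ.eigenvalues k * ‖toEigenbasis hρ X k l‖ ^ 2 : ℝ) : ℂ)
      / Fintype.card N := by
  rw [tau, ← trace_toEigenbasis hρ, toEigenbasis_mul, toEigenbasis_mul,
    toEigenbasis_conjTranspose, toEigenbasis_self]
  simp only [Matrix.trace, Matrix.diag, Matrix.mul_diagonal]
  simp only [Matrix.mul_apply, Matrix.conjTranspose_apply]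
  push_cast
  simp only [Finset.sum_mul, ← Complex.mul_conj', starRingEnd_apply]
  congr 1
  exact Finset.sum_congr rfl fun k _ => Finset.sum_congr rfl fun l _ => by ring

lemma tau_conjTranspose_mul_mul (X : Matrix N N ℂ) :
    tau (Xᴴ * X * ρ) = ((∑ k, ∑ l, hρ.eigenvalues l * ‖toEigenbasis hρ X k l‖ ^ 2 : ℝ) : ℂ)
      / Fintype.card N := by
  rw [tau, ← trace_toEigenbasis hρ, toEigenbasis_mul, toEigenbasis_mul,
    toEigenbasis_conjTranspose, toEigenbasis_self, Finset.sum_comm]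
  simp only [Matrix.trace, Matrix.diag, Matrix.mul_diagonal]
  simp only [Matrix.mul_apply, Matrix.conjTranspose_apply]
  push_cast
  simp only [Finset.sum_mul, ← Complex.mul_conj', starRingEnd_apply]
  congr 1
  exact Finset.sum_congr rfl fun k _ => Finset.sum_congr rfl fun l _ => by ring

lemma mpow_mul_mul_mpow (A : Matrix N N ℂ) (s t : ℝ) :
    mpow ρ s * A * mpow ρ t = ofEigenbasis hρ (Matrix.of fun k l =>
      ((hρ.eigenvalues k ^ s * hρ.eigenvalues l ^ t : ℝ) : ℂ) * toEigenbasis hρ A k l) := by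
  have h : (Matrix.of fun k l =>
      ((hρ.eigenvalues k ^ s * hρ.eigenvalues l ^ t : ℝ) : ℂ) * toEigenbasis hρ A k l)
      = Matrix.diagonal (fun i => ((hρ.eigenvalues i ^ s : ℝ) : ℂ)) * toEigenbasis hρ A *
        Matrix.diagonal (fun i => ((hρ.eigenvalues i ^ t : ℝ) : ℂ)) := by
    ext k l
    rw [Matrix.mul_diagonal, Matrix.diagonal_mul, Matrix.of_apply]
    push_cast
    ring
  rw [h, mpow, mpow, dif_pos hρ, dif_pos hρ]
  simp only [ofEigenbasis, toEigenbasis_apply, mul_assoc]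

/-- `[ρ]_α` acts as a Schur multiplier in the eigenbasis of `ρ`. -/
lemma toEigenbasis_sandwich (hρ : ρ.PosSemidef) (α : ℝ) (A : Matrix N N ℂ) (k l : N) :
    toEigenbasis hρ.1 (sandwich ρ α A) k l
      = (logMean α (hρ.1.eigenvalues k) (hρ.1.eigenvalues l) : ℂ)
        * toEigenbasis hρ.1 A k l := by
  set F : ℝ → Matrix N N ℂ := fun s => ofEigenbasis hρ.1 (Matrix.of fun k l =>
    ((Real.exp (α * (s - 1/2)) *
      (hρ.1.eigenvalues k ^ s * hρ.1.eigenvalues l ^ (1 - s)) : ℝ) : ℂ)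
        * toEigenbasis hρ.1 A k l) with hF
  have hint : ∀ i k, IntervalIntegrable (fun s => F s i k) volume 0 1 := fun i k => by
    simp only [hF, ofEigenbasis, Matrix.mul_apply, Matrix.of_apply]
    refine intervalIntegrable_finsetSum _ fun b _ => IntervalIntegrable.mul_const
      (intervalIntegrable_finsetSum _ fun c _ => IntervalIntegrable.const_mul
        (IntervalIntegrable.mul_const ?_ _) _) _
    have h := intervalIntegrable_rpow_mul_rpow α (hρ.eigenvalues_nonneg c)
      (hρ.eigenvalues_nonneg b) 0 1
    exact ⟨h.1.ofReal, h.2.ofReal⟩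
  have hs : sandwich ρ α A = entryIntegral F := by
    ext i k
    simp only [sandwich, entryIntegral, Matrix.of_apply]
    congr 1
    ext s
    rw [mpow_mul_mul_mpow hρ.1]
    simp only [hF, ofEigenbasis, Matrix.mul_apply, Matrix.of_apply, Finset.smul_sum,
      Finset.sum_mul, Complex.real_smul]
    refine Finset.sum_congr rfl fun b _ => Finset.sum_congr rfl fun c _ => ?_
    push_cast
    ring
  rw [hs, toEigenbasis_entryIntegral_apply hρ.1 hint]
  simp only [hF, toEigenbasis_ofEigenbasis, Matrix.of_apply]
  rw [intervalIntegral.integral_mul_const, intervalIntegral.integral_ofReal]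
  rfl

lemma re_star_mul_ofReal_mul (z : ℂ) (c : ℝ) : (star z * (c * z)).re = c * ‖z‖ ^ 2 := by
  have : star z * (c * z) = ((c * ‖z‖ ^ 2 : ℝ) : ℂ) := by
    push_cast
    rw [← Complex.mul_conj' z, ← starRingEnd_apply]
    ring
  rw [this, Complex.ofReal_re]

lemma re_gnsH_eq_sum (V W : J → Matrix N N ℂ) :
    (gnsH V W).re = (∑ j, ∑ k, ∑ l,
      (star (toEigenbasis hρ (V j) k l) * toEigenbasis hρ (W j) k l).re) / Fintype.card N := by
  simp only [gnsH, gns_eq_sum hρ, Complex.re_sum, Complex.div_natCast_re, ← Finset.sum_div]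

lemma re_gnsH_opOmega (hρ : ρ.PosSemidef) (ω : J → ℝ) (V : J → Matrix N N ℂ) :
    (gnsH V (opOmega ω ρ V)).re = (∑ j, ∑ k, ∑ l,
      logMean (ω j) (hρ.1.eigenvalues k) (hρ.1.eigenvalues l)
        * ‖toEigenbasis hρ.1 (V j) k l‖ ^ 2) / Fintype.card N := by
  rw [re_gnsH_eq_sum hρ.1]
  simp only [opOmega, toEigenbasis_sandwich hρ, re_star_mul_ofReal_mul]

lemma re_tau_dualWeight_mul (ω : J → ℝ) {X : J → ℝ → Matrix N N ℂ}
    (hX : ∀ j, ContinuousOn (X j) (Set.Icc 0 1)) :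
    (tau (dualWeight ω X * ρ)).re = -(1/2) * ((∑ j, ∑ k, ∑ l, ∫ θ in (0:ℝ)..1,
      tiltSeg (ω j) (hρ.eigenvalues k) (hρ.eigenvalues l) θ
        * ‖toEigenbasis hρ (X j θ) k l‖ ^ 2) / Fintype.card N) := by
  let L : Matrix N N ℂ →ₗ[ℂ] ℂ :=
    { toFun := fun M => tau (M * ρ)
      map_add' := fun A B => by simp [tau, add_mul, add_div]
      map_smul' := fun c A => by simp [tau, mul_div_assoc] }
  have hcont : ∀ j k l, ContinuousOn (fun θ =>
      tiltSeg (ω j) (hρ.eigenvalues k) (hρ.eigenvalues l) θ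
        * ‖toEigenbasis hρ (X j θ) k l‖ ^ 2) (Set.Icc 0 1) := fun j k l =>
    (continuous_tiltSeg _ _ _).continuousOn.mul (ContinuousOn.pow (ContinuousOn.norm
      ((continuous_apply_apply k l).comp_continuousOn
        ((continuous_toEigenbasis hρ).comp_continuousOn (hX j)))) 2)
  set F : ℝ → Matrix N N ℂ := fun θ => ∑ j,
    (((θ * Real.exp (ω j / 2) : ℝ) : ℂ) • (X j θ * (X j θ)ᴴ)
      + (((1 - θ) * Real.exp (-(ω j / 2)) : ℝ) : ℂ) • ((X j θ)ᴴ * X j θ)) with hF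
  have hFc : ContinuousOn F (Set.Icc 0 1) := by
    refine continuousOn_finsetSum _ fun j _ => ?_
    have hXs : ContinuousOn (fun θ => (X j θ)ᴴ) (Set.Icc 0 1) := (hX j).star
    have h1 : ContinuousOn (fun θ => X j θ * (X j θ)ᴴ) (Set.Icc 0 1) := (hX j).mul hXs
    have h2 : ContinuousOn (fun θ => (X j θ)ᴴ * X j θ) (Set.Icc 0 1) := hXs.mul (hX j)
    fun_prop
  have hLF : ∀ θ, L (F θ) = (((∑ j, ∑ k, ∑ l,
      tiltSeg (ω j) (hρ.eigenvalues k) (hρ.eigenvalues l) θ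
        * ‖toEigenbasis hρ (X j θ) k l‖ ^ 2) / Fintype.card N : ℝ) : ℂ) := fun θ => by
    have h1 : ∀ Y, L (Y * Yᴴ) = _ := fun Y => tau_mul_conjTranspose_mul hρ Y
    have h2 : ∀ Y, L (Yᴴ * Y) = _ := fun Y => tau_conjTranspose_mul_mul hρ Y
    simp only [hF, map_sum, map_add, map_smul, h1, h2, smul_eq_mul]
    push_cast
    rw [Finset.sum_div]
    refine Finset.sum_congr rfl fun j _ => ?_
    rw [mul_div_assoc', mul_div_assoc', ← add_div]
    congr 1
    simp only [Finset.mul_sum, ← Finset.sum_add_distrib]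
    refine Finset.sum_congr rfl fun k _ => Finset.sum_congr rfl fun l _ => ?_
    simp only [tiltSeg]
    push_cast
    ring
  have hL : tau (dualWeight ω X * ρ) = (-(1/2) : ℂ) * ∫ θ in (0:ℝ)..1, L (F θ) := by
    rw [← linearMap_entryIntegral L (intervalIntegrable_entry hFc)]
    exact L.map_smul (-(1/2) : ℂ) (entryIntegral F)
  rw [hL]
  simp only [hLF]
  rw [intervalIntegral.integral_ofReal, intervalIntegral.integral_div,
    intervalIntegral.integral_finsetSum fun j _ => intervalIntegrable_finsetSum _ fun k _ =>
      intervalIntegrable_finsetSum _ fun l _ => (hcont j k l).intervalIntegrable_zero_one]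
  simp only [intervalIntegral.integral_finsetSum fun k _ =>
      intervalIntegrable_finsetSum _ fun l _ => (hcont _ k l).intervalIntegrable_zero_one,
    intervalIntegral.integral_finsetSum fun l _ =>
      (hcont _ _ l).intervalIntegrable_zero_one]
  rw [show (-(1/2) : ℂ) = ((-(1/2) : ℝ) : ℂ) by push_cast; rfl, ← Complex.ofReal_mul,
    Complex.ofReal_re]

/-- The pair built from any continuous family `X` satisfies the dual constraint. -/
lemma dualWeight_feasible (hρ : ρ.PosSemidef) (ω : J → ℝ) {X : J → ℝ → Matrix N N ℂ}
    (hX : ∀ j, ContinuousOn (X j) (Set.Icc 0 1)) :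
    (tau (dualWeight ω X * ρ)).re + (1/2) * (gnsH (fun j => entryIntegral (X j))
      (opOmega ω ρ fun j => entryIntegral (X j))).re ≤ 0 := by
  rw [re_tau_dualWeight_mul hρ.1 ω hX, re_gnsH_opOmega hρ]
  have : (∑ j, ∑ k, ∑ l, logMean (ω j) (hρ.1.eigenvalues k) (hρ.1.eigenvalues l)
        * ‖toEigenbasis hρ.1 (entryIntegral (X j)) k l‖ ^ 2) / (Fintype.card N : ℝ)
      ≤ (∑ j, ∑ k, ∑ l, ∫ θ in (0:ℝ)..1,
      tiltSeg (ω j) (hρ.1.eigenvalues k) (hρ.1.eigenvalues l) θ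
        * ‖toEigenbasis hρ.1 (X j θ) k l‖ ^ 2) / Fintype.card N := by
    gcongr with j _ k _ l _
    rw [toEigenbasis_entryIntegral_apply hρ.1 (intervalIntegrable_entry (hX j))]
    exact logMean_mul_normSq_integral_le _ (hρ.eigenvalues_nonneg k) (hρ.eigenvalues_nonneg l)
      ((continuous_apply_apply k l).comp_continuousOn
        ((continuous_toEigenbasis hρ.1).comp_continuousOn (hX j)))
  linarith

/-- Feasible dual pairs obtained by rescaling the entries of `W` in the eigenbasis of `C`. -/
lemma exists_dual_pair {C : Matrix N N ℂ} (hC : C.IsHermitian) (ω : J → ℝ)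
    (W : J → Matrix N N ℂ) (g : J → N → N → ℝ → ℝ)
    (hg : ∀ j k l, ContinuousOn (g j k l) (Set.Icc 0 1)) :
    ∃ (a : Matrix N N ℂ) (V : J → Matrix N N ℂ), (a.IsHermitian ∧
        ∀ ρ : Matrix N N ℂ, ρ.PosSemidef → tau ρ = 1 →
          (tau (a * ρ)).re + (1/2) * (gnsH V (opOmega ω ρ V)).re ≤ 0) ∧
      (tau (a * C)).re + (gnsH V W).re = (∑ j, ∑ k, ∑ l,
        (∫ θ in (0:ℝ)..1, (g j k l θ - 1/2 *
          (tiltSeg (ω j) (hC.eigenvalues k) (hC.eigenvalues l) θ * g j k l θ ^ 2)))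
            * ‖toEigenbasis hC (W j) k l‖ ^ 2) / Fintype.card N := by
  set X : J → ℝ → Matrix N N ℂ := fun j θ => ofEigenbasis hC
    (Matrix.of fun k l => (g j k l θ : ℂ) * toEigenbasis hC (W j) k l) with hXdef
  have hX : ∀ j, ContinuousOn (X j) (Set.Icc 0 1) := fun j => by
    refine (continuous_ofEigenbasis hC).comp_continuousOn ?_
    refine continuousOn_pi.2 fun k => continuousOn_pi.2 fun l => ?_
    exact (Complex.continuous_ofReal.comp_continuousOn (hg j k l)).mul continuousOn_const
  refine ⟨dualWeight ω X, fun j => entryIntegral (X j),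
    ⟨dualWeight_isHermitian ω X, fun ρ hρ _ => dualWeight_feasible hρ ω hX⟩, ?_⟩
  rw [re_tau_dualWeight_mul hC ω hX, re_gnsH_eq_sum hC, mul_div_assoc', ← add_div]
  simp only [fun j => toEigenbasis_entryIntegral_apply hC (intervalIntegrable_entry (hX j))]
  simp only [hXdef, toEigenbasis_ofEigenbasis, Matrix.of_apply, intervalIntegral.integral_mul_const,
    intervalIntegral.integral_ofReal, Finset.mul_sum, ← Finset.sum_add_distrib]
  congr 1
  refine Finset.sum_congr rfl fun j _ => Finset.sum_congr rfl fun k _ =>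
    Finset.sum_congr rfl fun l _ => ?_
  have hint : IntervalIntegrable (fun θ => 1/2 *
      (tiltSeg (ω j) (hC.eigenvalues k) (hC.eigenvalues l) θ * g j k l θ ^ 2)) volume 0 1 :=
    ContinuousOn.intervalIntegrable_zero_one (continuousOn_const.mul
      ((continuous_tiltSeg _ _ _).continuousOn.mul ((hg j k l).pow 2)))
  rw [intervalIntegral.integral_sub (hg j k l).intervalIntegrable_zero_one hint,
    intervalIntegral.integral_const_mul]
  simp only [norm_mul, Complex.norm_real, Real.norm_eq_abs, mul_pow, sq_abs, ← mul_assoc]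
  rw [intervalIntegral.integral_mul_const]
  have h := re_star_mul_ofReal_mul (toEigenbasis hC (W j) k l) (∫ θ in (0:ℝ)..1, g j k l θ)
  have h' : star (((∫ θ in (0:ℝ)..1, g j k l θ : ℝ) : ℂ) * toEigenbasis hC (W j) k l)
      * toEigenbasis hC (W j) k l = star (toEigenbasis hC (W j) k l) *
      (((∫ θ in (0:ℝ)..1, g j k l θ : ℝ) : ℂ) * toEigenbasis hC (W j) k l) := by
    rw [star_mul', Complex.star_def, Complex.conj_ofReal]
    ring
  rw [h', h]
  ring

end MatrixTools

lemma re_star_mul_ofReal_mul_le {c : ℝ} (hc : 0 ≤ c) (v u : ℂ) :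
    (star v * (c * u)).re ≤ c * ‖u‖ ^ 2 / 2 + c * ‖v‖ ^ 2 / 2 := by
  have h : (star v * (c * u)).re = c * (star v * u).re := by
    rw [mul_left_comm, Complex.re_ofReal_mul]
  have h1 : (star v * u).re ≤ ‖v‖ * ‖u‖ := by
    simpa [norm_mul] using Complex.re_le_norm (star v * u)
  rw [h]
  nlinarith [mul_le_mul_of_nonneg_left h1 hc, mul_nonneg hc (sq_nonneg (‖v‖ - ‖u‖))]

lemma exists_degenerate_entry {N : Type*} [Fintype N] [DecidableEq N] {J : Type*} [Fintype J]
    (ω : J → ℝ) {C : Matrix N N ℂ} (hC : C.PosSemidef) (W : J → Matrix N N ℂ)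
    (h : ¬ ∃ U, opOmega ω C U = W ∧ ∀ U', opOmega ω C U' = 0 → gnsH U U' = 0) :
    ∃ j k l, (hC.1.eigenvalues k = 0 ∨ hC.1.eigenvalues l = 0) ∧
      toEigenbasis hC.1 (W j) k l ≠ 0 := by
  contrapose! h
  have hW : ∀ j k l, logMean (ω j) (hC.1.eigenvalues k) (hC.1.eigenvalues l) = 0 →
      toEigenbasis hC.1 (W j) k l = 0 := fun j k l hL => by
    refine h j k l ?_
    by_contra! hne
    exact (logMean_pos (ω j) (lt_of_le_of_ne (hC.eigenvalues_nonneg k) hne.1.symm)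
      (lt_of_le_of_ne (hC.eigenvalues_nonneg l) hne.2.symm)).ne' hL
  set U : J → Matrix N N ℂ := fun j => ofEigenbasis hC.1 (Matrix.of fun k l =>
    ((logMean (ω j) (hC.1.eigenvalues k) (hC.1.eigenvalues l) : ℂ))⁻¹ *
      toEigenbasis hC.1 (W j) k l) with hUdef
  have hU : ∀ j k l, toEigenbasis hC.1 (U j) k l =
      ((logMean (ω j) (hC.1.eigenvalues k) (hC.1.eigenvalues l) : ℂ))⁻¹ *
      toEigenbasis hC.1 (W j) k l := fun j k l => by
    simp only [hUdef, toEigenbasis_ofEigenbasis, Matrix.of_apply]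
  refine ⟨U, ?_, fun U' hU' => ?_⟩
  · funext j
    apply toEigenbasis_injective hC.1
    ext k l
    rw [opOmega, toEigenbasis_sandwich hC, hU]
    by_cases hL : logMean (ω j) (hC.1.eigenvalues k) (hC.1.eigenvalues l) = 0
    · rw [hW j k l hL, mul_zero, mul_zero]
    · rw [mul_inv_cancel_left₀ (Complex.ofReal_ne_zero.2 hL)]
  · simp only [gnsH, gns_eq_sum hC.1]
    refine Finset.sum_eq_zero fun j _ => ?_
    rw [Finset.sum_eq_zero, zero_div]
    refine fun k _ => Finset.sum_eq_zero fun l _ => ?_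
    have hz : (logMean (ω j) (hC.1.eigenvalues k) (hC.1.eigenvalues l) : ℂ)
        * toEigenbasis hC.1 (U' j) k l = 0 := by
      rw [← toEigenbasis_sandwich hC]
      have := congrFun hU' j
      rw [opOmega] at this
      simp [this]
    rcases mul_eq_zero.1 hz with hL | hz
    · rw [hU, hL]
      simp
    · rw [hz, mul_zero]

/-- If `W` has a nonzero entry in a degenerate direction of `[C]_ω`, the dual values are
unbounded. -/
lemma exists_dual_pair_ge {N : Type*} [Fintype N] [DecidableEq N] {J : Type*} [Fintype J]
    (ω : J → ℝ) {C : Matrix N N ℂ} (hC : C.PosSemidef) (hn : 0 < (Fintype.card N : ℝ))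
    (W : J → Matrix N N ℂ) {j₀ : J} {k₀ l₀ : N}
    (hz : hC.1.eigenvalues k₀ = 0 ∨ hC.1.eigenvalues l₀ = 0)
    (hne : toEigenbasis hC.1 (W j₀) k₀ l₀ ≠ 0) (T : ℝ) :
    ∃ (a : Matrix N N ℂ) (V : J → Matrix N N ℂ), (a.IsHermitian ∧
        ∀ ρ : Matrix N N ℂ, ρ.PosSemidef → tau ρ = 1 →
          (tau (a * ρ)).re + (1/2) * (gnsH V (opOmega ω ρ V)).re ≤ 0) ∧
      T ≤ (tau (a * C)).re + (gnsH V W).re := by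
  set x := hC.1.eigenvalues k₀
  set y := hC.1.eigenvalues l₀
  have hx0 : 0 ≤ x := hC.eigenvalues_nonneg k₀
  have hy0 : 0 ≤ y := hC.eigenvalues_nonneg l₀
  set w := ‖toEigenbasis hC.1 (W j₀) k₀ l₀‖ ^ 2
  have hw0 : 0 < w := by positivity
  obtain ⟨ε, hε, hT⟩ := exists_integral_inv_tiltSeg_add_ge (ω j₀) hx0 hy0 hz
    (2 * (T * Fintype.card N / w))
  have hpos : ∀ θ ∈ Set.Icc (0:ℝ) 1, 0 < tiltSeg (ω j₀) x y θ + ε := fun θ hθ =>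
    add_pos_of_nonneg_of_pos (tiltSeg_nonneg _ hx0 hy0 hθ) hε
  set f : ℝ → ℝ := fun θ => (tiltSeg (ω j₀) x y θ + ε)⁻¹
  have hfc : ContinuousOn f (Set.Icc 0 1) :=
    ((continuous_tiltSeg _ _ _).continuousOn.add continuousOn_const).inv₀
      fun θ hθ => (hpos θ hθ).ne'
  obtain ⟨a, V, haV, hval⟩ := exists_dual_pair hC.1 ω W
    (fun j k l => if j = j₀ ∧ k = k₀ ∧ l = l₀ then f else fun _ => 0)
    (fun j k l => by
      split_ifs
      · exact hfc
      · exact continuousOn_const)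
  refine ⟨a, V, haV, ?_⟩
  have hint : T * Fintype.card N / w ≤ ∫ θ in (0:ℝ)..1,
      (f θ - 1/2 * (tiltSeg (ω j₀) x y θ * f θ ^ 2)) := by
    have hlow : ContinuousOn (fun θ => 1/2 * f θ) (Set.Icc 0 1) := continuousOn_const.mul hfc
    have hupp : ContinuousOn (fun θ => f θ - 1/2 * (tiltSeg (ω j₀) x y θ * f θ ^ 2))
        (Set.Icc 0 1) :=
      hfc.sub (continuousOn_const.mul
        ((continuous_tiltSeg (ω j₀) x y).continuousOn.mul (hfc.pow 2)))
    have hmono := intervalIntegral.integral_mono_on zero_le_one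
      hlow.intervalIntegrable_zero_one hupp.intervalIntegrable_zero_one
      fun θ hθ => by
        have hp := hpos θ hθ
        have hf0 : 0 < f θ := inv_pos.2 hp
        have hmul : (tiltSeg (ω j₀) x y θ + ε) * f θ = 1 := mul_inv_cancel₀ hp.ne'
        have h1 : tiltSeg (ω j₀) x y θ * f θ ≤ 1 := by nlinarith [mul_pos hε hf0]
        nlinarith
    rw [intervalIntegral.integral_const_mul] at hmono
    linarith
  rw [hval, le_div_iff₀ hn]
  rw [Finset.sum_eq_single j₀ _ (by simp), Finset.sum_eq_single k₀ _ (by simp),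
    Finset.sum_eq_single l₀ _ (by simp)]
  · simp only [true_and, if_true]
    rwa [div_le_iff₀ hw0] at hint
  · intro l _ hl
    simp [hl]
  · intro k _ hk
    simp [hk]
  · intro j _ hj
    simp [hj]

/-- **Legendre transform computation.**  For a density matrix `C` and `W ∈ H`,
`sup { τ(aC) + Re⟨V,W⟩ : a hermitian, V ∈ H with
τ(aρ) + ½⟨V, [ρ]_ω V⟩ ≤ 0 for every density matrix ρ } = ½⟨W, [C]_ω⁻¹ W⟩`
as an identity in `[0,∞]`. -/
theorem legendre_transform_invQuad
    {N : Type*} [Fintype N] [DecidableEq N] {J : Type*} [Fintype J]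
    (ω : J → ℝ) (C : Matrix N N ℂ) (hC : C.PosSemidef) (hCtr : tau C = 1)
    (W : J → Matrix N N ℂ) :
    (⨆ (a : Matrix N N ℂ) (V : J → Matrix N N ℂ)
      (_ : a.IsHermitian ∧
        ∀ ρ : Matrix N N ℂ, ρ.PosSemidef → tau ρ = 1 →
          (tau (a * ρ)).re + (1/2) * (gnsH V (opOmega ω ρ V)).re ≤ 0),
        ENNReal.ofReal ((tau (a * C)).re + (gnsH V W).re)) =
      invQuadH (opOmega ω C) W / 2 := by
  have hn : 0 < (Fintype.card N : ℝ) := by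
    rw [Nat.cast_pos, Nat.pos_iff_ne_zero]
    intro h
    simp [tau, h] at hCtr
  set c := hC.1.eigenvalues
  have hc0 : ∀ k, 0 ≤ c k := hC.eigenvalues_nonneg
  unfold invQuadH
  split_ifs with h
  · have hU := h.choose_spec.1
    set U := h.choose
    have hW : ∀ j k l, toEigenbasis hC.1 (W j) k l
        = (logMean (ω j) (c k) (c l) : ℂ) * toEigenbasis hC.1 (U j) k l := fun j k l => by
      rw [← hU]
      exact toEigenbasis_sandwich hC (ω j) (U j) k l
    have hhalf : ENNReal.ofReal (gnsH U (opOmega ω C U)).re / 2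
        = ENNReal.ofReal ((gnsH U (opOmega ω C U)).re / 2) := by
      rw [ENNReal.ofReal_div_of_pos two_pos, ENNReal.ofReal_ofNat]
    rw [hhalf, re_gnsH_opOmega hC]
    apply le_antisymm
    · refine iSup_le fun a => iSup_le fun V => iSup_le fun haV => ENNReal.ofReal_le_ofReal ?_
      have hle := haV.2 C hC hCtr
      rw [re_gnsH_opOmega hC] at hle
      rw [re_gnsH_eq_sum hC.1]
      have key : (∑ j, ∑ k, ∑ l,
          (star (toEigenbasis hC.1 (V j) k l) * toEigenbasis hC.1 (W j) k l).re)
            / (Fintype.card N : ℝ)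
          ≤ (∑ j, ∑ k, ∑ l, (logMean (ω j) (c k) (c l) * ‖toEigenbasis hC.1 (U j) k l‖ ^ 2 / 2
            + logMean (ω j) (c k) (c l) * ‖toEigenbasis hC.1 (V j) k l‖ ^ 2 / 2))
            / (Fintype.card N : ℝ) := by
        gcongr with j _ k _ l _
        rw [hW]
        exact re_star_mul_ofReal_mul_le (logMean_nonneg _ (hc0 k) (hc0 l)) _ _
      simp only [Finset.sum_add_distrib, ← Finset.sum_div] at key
      rw [add_div, div_right_comm _ (2 : ℝ), div_right_comm _ (2 : ℝ)] at key
      linarith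
    · obtain ⟨a, V, haV, hval⟩ := exists_dual_pair hC.1 ω W
        (fun j k l => if 0 < c k ∧ 0 < c l then fun θ => (tiltSeg (ω j) (c k) (c l) θ)⁻¹
          else fun _ => 0)
        (fun j k l => by
          split_ifs with hkl
          · exact continuousOn_inv_tiltSeg _ hkl.1 hkl.2
          · exact continuousOn_const)
      refine le_trans (ENNReal.ofReal_le_ofReal (le_of_eq ?_))
        (le_iSup_of_le a (le_iSup_of_le V (le_iSup_of_le haV le_rfl)))
      rw [hval, div_right_comm, Finset.sum_div]
      congr 1
      refine Finset.sum_congr rfl fun j _ => ?_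
      rw [Finset.sum_div]
      refine Finset.sum_congr rfl fun k _ => ?_
      rw [Finset.sum_div]
      refine Finset.sum_congr rfl fun l _ => ?_
      rw [hW, norm_mul, mul_pow, Complex.norm_real, Real.norm_eq_abs, sq_abs]
      by_cases hkl : 0 < c k ∧ 0 < c l
      · simp only [if_pos hkl]
        have hL := logMean_pos (ω j) hkl.1 hkl.2
        have hint : (∫ θ in (0:ℝ)..1, ((tiltSeg (ω j) (c k) (c l) θ)⁻¹ -
            1/2 * (tiltSeg (ω j) (c k) (c l) θ * (tiltSeg (ω j) (c k) (c l) θ)⁻¹ ^ 2)))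
            = 1/2 * (logMean (ω j) (c k) (c l))⁻¹ := by
          rw [← integral_inv_tiltSeg (ω j) hkl.1 hkl.2, ← intervalIntegral.integral_const_mul]
          refine intervalIntegral.integral_congr fun θ hθ => ?_
          rw [Set.uIcc_of_le zero_le_one] at hθ
          have hA := tiltSeg_pos (ω j) hkl.1 hkl.2 hθ
          field_simp
          ring
        rw [hint]
        field_simp
        exact mul_comm _ _
      · simp only [if_neg hkl]
        have hz : c k = 0 ∨ c l = 0 := by
          by_contra! hne
          exact hkl ⟨lt_of_le_of_ne (hc0 k) hne.1.symm, lt_of_le_of_ne (hc0 l) hne.2.symm⟩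
        rw [logMean_eq_zero (ω j) hz]
        simp
  · rw [ENNReal.top_div_of_ne_top (by simp)]
    obtain ⟨j, k, l, hz, hne⟩ := exists_degenerate_entry ω hC W h
    refine ENNReal.eq_top_of_forall_nnreal_le fun T => ?_
    obtain ⟨a, V, haV, hT⟩ := exists_dual_pair_ge ω hC hn W hz hne T
    refine le_trans ?_ (le_iSup_of_le a (le_iSup_of_le V (le_iSup_of_le haV le_rfl)))
    rw [← ENNReal.ofReal_coe_nnreal]
    exact ENNReal.ofReal_le_ofReal hT
end

section
/- Fix α ∈ ℝ. The map f from the positive definite matrices in M_n(ℂ) to the linear endomorphisms of M_n(ℂ), f(X) = [X]_α, is infinitely Fréchet differentiable, and for all positive definite A, B ∈ M_n(ℂ) the operator Df(B)[A] − f(A) is positive semidefinite on the Hilbert space (M_n(ℂ), ⟨·,·⟩), i.e. Df(B)[A] ≥ f(A) in the Loewner order; moreover Df(A)[A] = f(A), so equality holds when A = B. -/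
open MeasureTheory Matrix
open scoped ENNReal Classical ComplexOrder

attribute [local instance] Matrix.normedAddCommGroup Matrix.normedSpace

/-- `T` is a positive semidefinite (self-adjoint) operator on the Hilbert space
`(M_n(ℂ), ⟨·,·⟩)` with the GNS inner product; `S ≥ T` in the Loewner order means
`OpPosSemidef (S - T)`. -/
def OpPosSemidef {N : Type*} [Fintype N] (T : Matrix N N ℂ → Matrix N N ℂ) : Prop :=
  (∀ A B : Matrix N N ℂ, gns (T A) B = gns A (T B)) ∧
  ∀ A : Matrix N N ℂ, 0 ≤ (gns A (T A)).re

theorem contDiffOn_intervalIntegral {P E : Type*} [NormedAddCommGroup P] [NormedSpace ℝ P]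
    [NormedAddCommGroup E] [NormedSpace ℝ E] {S : Set P} (hS : IsOpen S) {g : P → ℝ → E}
    (hg : ContDiffOn ℝ (⊤ : ℕ∞) (fun q : P × ℝ => g q.1 q.2) (S ×ˢ Set.univ))
    {a b : ℝ} (hab : a ≤ b) :
    ContDiffOn ℝ (⊤ : ℕ∞) (fun p => ∫ t in a..b, g p t) S := by
  have hR : 0 < |a| + |b| + 1 := by positivity
  let φ : ContDiffBump (0 : ℝ) := ⟨|a| + |b| + 1, |a| + |b| + 2, hR, by linarith⟩
  have hconv := contDiffOn_convolution_right_with_param_comp (𝕜 := ℝ) (μ := volume)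
    (n := (⊤ : ℕ∞)) (ContinuousLinearMap.lsmul ℝ ℝ) (s := S) (v := fun _ => (0 : ℝ))
    contDiffOn_const (f := (Set.Ioc a b).indicator fun _ => (1 : ℝ))
    (g := fun p x => φ x • g p (-x)) (k := Metric.closedBall 0 (|a| + |b| + 2)) hS
    (isCompact_closedBall _ _) ?_ ?_ ?_
  · refine hconv.congr fun p _ => ?_
    rw [intervalIntegral.integral_of_le hab, convolution_def,
      ← integral_indicator measurableSet_Ioc]
    refine integral_congr_ae (Filter.Eventually.of_forall fun t => ?_)
    by_cases ht : t ∈ Set.Ioc a b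
    · have h1 : φ (-t) = 1 := by
        apply φ.one_of_mem_closedBall
        simp only [Metric.mem_closedBall, dist_zero_right, Real.norm_eq_abs, abs_neg, φ]
        have := abs_le_max_abs_abs ht.1.le ht.2
        have := max_le_add_of_nonneg (abs_nonneg a) (abs_nonneg b)
        linarith
      simp [ht, h1]
    · simp [ht]
  · intro p x _ hx
    have : φ x = 0 := by
      apply φ.zero_of_le_dist
      simp only [Metric.mem_closedBall, not_le] at hx
      exact hx.le
    simp [this]
  · exact ((integrable_indicator_iff measurableSet_Ioc).2
      (integrableOn_const (by simp))).locallyIntegrable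
  · have h1 : ContDiffOn ℝ (⊤ : ℕ∞) (fun q : P × ℝ => φ q.2) (S ×ˢ Set.univ) :=
      (φ.contDiff.comp contDiff_snd).contDiffOn
    have h2 : ContDiffOn ℝ (⊤ : ℕ∞) (fun q : P × ℝ => g q.1 (-q.2)) (S ×ˢ Set.univ) :=
      hg.comp (f := fun q : P × ℝ => (q.1, -q.2))
        (contDiff_fst.prodMk contDiff_snd.neg).contDiffOn fun q hq => ⟨hq.1, trivial⟩
    exact h1.smul h2

section Logarithm

variable {R : Type*} [NormedRing R] [NormedAlgebra ℝ R]

/-- The elements of `R` whose segment to `1` consists of units. -/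
def unitSegment (R : Type*) [NormedRing R] [NormedAlgebra ℝ R] : Set R :=
  {X | ∀ t ∈ Set.Icc (0 : ℝ) 1, IsUnit ((1 - t) • (1 : R) + t • X)}

theorem isOpen_unitSegment [CompleteSpace R] : IsOpen (unitSegment R) := by
  rw [isOpen_iff_mem_nhds]
  intro X hX
  refine isCompact_Icc.eventually_forall_of_forall_eventually fun t ht => ?_
  have hc : Continuous fun q : R × ℝ => (1 - q.2) • (1 : R) + q.2 • q.1 := by fun_prop
  exact hc.continuousAt.eventually (Units.isOpen.mem_nhds (hX t ht))

/-- The logarithm `∫₀¹ (X - 1) ((1 - t) + t X)⁻¹ dt`, reparametrized by `t = sin² u`. -/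
noncomputable def segmentLog (X : R) : R :=
  ∫ u in (0 : ℝ)..(Real.pi / 2), (2 * Real.sin u * Real.cos u) •
    ((X - 1) * Ring.inverse ((1 - Real.sin u ^ 2) • (1 : R) + (Real.sin u ^ 2) • X))

theorem contDiffOn_segmentLog [CompleteSpace R] :
    ContDiffOn ℝ (⊤ : ℕ∞) (segmentLog (R := R)) (unitSegment R) := by
  refine contDiffOn_intervalIntegral isOpen_unitSegment ?_ (by positivity)
  intro q hq
  have hu : IsUnit ((1 - Real.sin q.2 ^ 2) • (1 : R) + (Real.sin q.2 ^ 2) • q.1) :=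
    hq.1 _ ⟨sq_nonneg _, Real.sin_sq_le_one _⟩
  have h0 : ContDiffAt ℝ (⊤ : ℕ∞) (fun q : R × ℝ =>
      (1 - Real.sin q.2 ^ 2) • (1 : R) + (Real.sin q.2 ^ 2) • q.1) q := by fun_prop
  have h1 : ContDiffAt ℝ (⊤ : ℕ∞) (fun q : R × ℝ =>
      Ring.inverse ((1 - Real.sin q.2 ^ 2) • (1 : R) + (Real.sin q.2 ^ 2) • q.1)) q := by
    have := contDiffAt_ringInverse (n := (⊤ : ℕ∞)) ℝ hu.unit
    exact ContDiffAt.comp q this h0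
  have h2 : ContDiffAt ℝ (⊤ : ℕ∞) (fun q : R × ℝ => q.1 - 1) q := by fun_prop
  have h3 : ContDiffAt ℝ (⊤ : ℕ∞) (fun q : R × ℝ => 2 * Real.sin q.2 * Real.cos q.2) q := by
    fun_prop
  exact (h3.smul (h2.mul h1)).contDiffWithinAt

theorem integral_sin_sq_log {x : ℝ} (hx : 0 < x) :
    ∫ u in (0 : ℝ)..(Real.pi / 2), (2 * Real.sin u * Real.cos u) *
      ((x - 1) * ((1 - Real.sin u ^ 2) + Real.sin u ^ 2 * x)⁻¹) = Real.log x := by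
  have hpos : ∀ u, 0 < (1 - Real.sin u ^ 2) + Real.sin u ^ 2 * x := fun u => by
    rcases (sq_nonneg (Real.sin u)).eq_or_lt with h | h
    · rw [← h]; norm_num
    · have := Real.sin_sq_le_one u
      nlinarith [mul_pos h hx]
  have hd : ∀ u, HasDerivAt (fun u => Real.log ((1 - Real.sin u ^ 2) + Real.sin u ^ 2 * x))
      ((2 * Real.sin u * Real.cos u) *
        ((x - 1) * ((1 - Real.sin u ^ 2) + Real.sin u ^ 2 * x)⁻¹)) u := fun u => by
    have h : HasDerivAt (fun u => Real.sin u ^ 2) (2 * Real.sin u * Real.cos u) u := by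
      simpa using (Real.hasDerivAt_sin u).fun_pow 2
    have h' : HasDerivAt (fun u => (1 - Real.sin u ^ 2) + Real.sin u ^ 2 * x)
        (-(2 * Real.sin u * Real.cos u) + 2 * Real.sin u * Real.cos u * x) u :=
      (h.const_sub 1).fun_add (h.mul_const x)
    convert h'.log (hpos u).ne' using 1
    ring
  rw [intervalIntegral.integral_eq_sub_of_hasDerivAt (fun u _ => hd u)]
  · simp
  · apply Continuous.intervalIntegrable
    exact Continuous.mul (by fun_prop) (continuous_const.mul
      (Continuous.inv₀ (by fun_prop) fun u => (hpos u).ne'))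

theorem map_mem_unitSegment {N : Type*} [Fintype N] (Φ : (N → ℝ) →ₐ[ℝ] R) {d : N → ℝ}
    (hd : ∀ i, 0 < d i) : Φ d ∈ unitSegment R := by
  intro t ht
  have : (1 - t) • (1 : R) + t • Φ d = Φ ((1 - t) • 1 + t • d) := by simp
  rw [this]
  refine IsUnit.map Φ (Pi.isUnit_iff.2 fun i => isUnit_iff_ne_zero.2 (ne_of_gt ?_))
  simp only [Pi.add_apply, Pi.smul_apply, Pi.one_apply, smul_eq_mul, mul_one]
  rcases ht.1.eq_or_lt with h | h
  · rw [← h]; norm_num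
  · nlinarith [mul_pos h (hd i), ht.2]

theorem segmentLog_map {N : Type*} [Fintype N] [CompleteSpace R] (Φ : (N → ℝ) →ₐ[ℝ] R) {d : N → ℝ}
    (hd : ∀ i, 0 < d i) : segmentLog (Φ d) = Φ fun i => Real.log (d i) := by
  have hpos : ∀ u i, 0 < (1 - Real.sin u ^ 2) + Real.sin u ^ 2 * d i := fun u i => by
    rcases (sq_nonneg (Real.sin u)).eq_or_lt with h | h
    · rw [← h]; norm_num
    · have := Real.sin_sq_le_one u
      nlinarith [mul_pos h (hd i)]
  let Ψ : (N → ℝ) →L[ℝ] R := LinearMap.toContinuousLinearMap Φ.toLinearMap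
  let w : ℝ → N → ℝ := fun u i => (2 * Real.sin u * Real.cos u) *
      ((d i - 1) * ((1 - Real.sin u ^ 2) + Real.sin u ^ 2 * d i)⁻¹)
  have hw : Continuous w := continuous_pi fun i => Continuous.mul (by fun_prop)
    (continuous_const.mul (Continuous.inv₀ (by fun_prop) fun u => (hpos u i).ne'))
  have h1 : segmentLog (Φ d) = ∫ u in (0 : ℝ)..(Real.pi / 2), Ψ (w u) := by
    refine intervalIntegral.integral_congr fun u _ => ?_
    have hinv : Ring.inverse ((1 - Real.sin u ^ 2) • (1 : R) + (Real.sin u ^ 2) • Φ d)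
        = Φ fun i => ((1 - Real.sin u ^ 2) + Real.sin u ^ 2 * d i)⁻¹ := by
      have hm : (1 - Real.sin u ^ 2) • (1 : R) + (Real.sin u ^ 2) • Φ d
          = Φ fun i => ((1 - Real.sin u ^ 2) + Real.sin u ^ 2 * d i) := by
        rw [← map_one Φ, ← map_smul, ← map_smul, ← map_add]
        congr 1; ext i; simp
      rw [hm]
      have hmul : (Φ fun i => ((1 - Real.sin u ^ 2) + Real.sin u ^ 2 * d i)) *
          (Φ fun i => ((1 - Real.sin u ^ 2) + Real.sin u ^ 2 * d i)⁻¹) = 1 := by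
        rw [← map_mul, ← map_one Φ]
        congr 1; ext i
        exact mul_inv_cancel₀ (hpos u i).ne'
      have hmul' : (Φ fun i => ((1 - Real.sin u ^ 2) + Real.sin u ^ 2 * d i)⁻¹) *
          (Φ fun i => ((1 - Real.sin u ^ 2) + Real.sin u ^ 2 * d i)) = 1 := by
        rw [← map_mul, ← map_one Φ]
        congr 1; ext i
        exact inv_mul_cancel₀ (hpos u i).ne'
      exact Ring.inverse_unit ⟨_, _, hmul, hmul'⟩
    simp only [hinv]
    rw [← map_one Φ, ← map_sub, ← map_mul, ← map_smul]
    rfl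
  rw [h1, Ψ.intervalIntegral_comp_comm (hw.intervalIntegrable _ _)]
  change Φ _ = _
  congr 1
  ext i
  rw [← integral_sin_sq_log (hd i)]
  exact ((ContinuousLinearMap.proj (R := ℝ) (φ := fun _ : N => ℝ) i).intervalIntegral_comp_comm
    (hw.intervalIntegrable 0 (Real.pi / 2))).symm

theorem exp_smul_segmentLog_map {N : Type*} [Fintype N] [CompleteSpace R] (Φ : (N → ℝ) →ₐ[ℝ] R)
    {d : N → ℝ} (hd : ∀ i, 0 < d i) (s : ℝ) :
    NormedSpace.exp (s • segmentLog (Φ d)) = Φ fun i => d i ^ s := by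
  have hΦ : Continuous Φ := LinearMap.continuous_of_finiteDimensional Φ.toLinearMap
  let : Algebra ℚ R := Algebra.restrictScalars ℚ ℝ R
  rw [segmentLog_map Φ hd, ← map_smul, ← NormedSpace.map_exp Φ hΦ]
  congr 1
  ext i
  rw [Pi.coe_exp, ← Real.exp_eq_exp_ℝ, Real.rpow_def_of_pos (hd i)]
  simp [mul_comm]

/-- A smooth extension of `X ↦ ∫₀¹ e^{α(s - 1/2)} X^s C X^{1-s} ds` to `unitSegment R`. -/
noncomputable def smoothSandwich (α : ℝ) (C X : R) : R :=
  ∫ s in (0 : ℝ)..1, Real.exp (α * (s - 1 / 2)) •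
    (NormedSpace.exp (s • segmentLog X) * C * NormedSpace.exp ((1 - s) • segmentLog X))

theorem contDiffOn_smoothSandwich [CompleteSpace R] (α : ℝ) (C : R) :
    ContDiffOn ℝ (⊤ : ℕ∞) (smoothSandwich α C) (unitSegment R) := by
  refine contDiffOn_intervalIntegral isOpen_unitSegment ?_ zero_le_one
  have hlog : ContDiffOn ℝ (⊤ : ℕ∞) (fun q : R × ℝ => segmentLog q.1)
      (unitSegment R ×ˢ Set.univ) :=
    contDiffOn_segmentLog.comp contDiff_fst.contDiffOn fun q hq => hq.1
  have hexp : ContDiff ℝ (⊤ : ℕ∞) (NormedSpace.exp : R → R) :=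
    contDiff_iff_contDiffAt.2 fun x => (NormedSpace.exp_analytic (𝕂 := ℝ) x).contDiffAt
  have hs : ContDiff ℝ (⊤ : ℕ∞) (fun q : R × ℝ => q.2) := contDiff_snd
  have h1 := hexp.comp_contDiffOn (hs.contDiffOn.smul hlog)
  have h2 := hexp.comp_contDiffOn (((contDiff_const (c := (1 : ℝ))).sub hs).contDiffOn.smul hlog)
  have h3 : ContDiff ℝ (⊤ : ℕ∞) (fun q : R × ℝ => Real.exp (α * (q.2 - 1 / 2))) := by fun_prop
  exact h3.contDiffOn.smul ((h1.mul contDiffOn_const).mul h2)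

end Logarithm

section Spectral

variable {N : Type*} [Fintype N] [DecidableEq N]

/-- The homomorphism `v ↦ U diag(v) U*` from real diagonal matrices. -/
noncomputable def spectralHom (U : unitaryGroup N ℂ) : (N → ℝ) →ₐ[ℝ] Matrix N N ℂ where
  toFun v := (U : Matrix N N ℂ) * diagonal (fun i => (v i : ℂ)) * star (U : Matrix N N ℂ)
  map_one' := by simp
  map_mul' v w := by
    have h : star (U : Matrix N N ℂ) * U = 1 := Unitary.coe_star_mul_self U
    have hd : diagonal (fun i => ((v * w) i : ℂ)) =
        diagonal (fun i => (v i : ℂ)) * diagonal (fun i => (w i : ℂ)) := by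
      simp
    calc _ = (U : Matrix N N ℂ) * diagonal (fun i => (v i : ℂ)) *
          (star (U : Matrix N N ℂ) * U) * diagonal (fun i => (w i : ℂ)) *
            star (U : Matrix N N ℂ) := by rw [h, hd]; simp only [mul_one, mul_assoc]
      _ = _ := by simp only [mul_assoc]
  map_zero' := by simp
  map_add' v w := by
    have hd : diagonal (fun i => ((v + w) i : ℂ)) =
        diagonal (fun i => (v i : ℂ)) + diagonal (fun i => (w i : ℂ)) := by
      simp
    rw [hd, mul_add, add_mul]
  commutes' r := by
    have hd : diagonal (fun i => ((algebraMap ℝ (N → ℝ) r i : ℝ) : ℂ)) =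
        (r : ℂ) • (1 : Matrix N N ℂ) := by
      rw [smul_one_eq_diagonal]; rfl
    rw [hd, mul_smul_comm, mul_one, smul_mul_assoc,
      show (U : Matrix N N ℂ) * star (U : Matrix N N ℂ) = 1 from Unitary.coe_mul_star_self U,
      Algebra.algebraMap_eq_smul_one, Complex.coe_smul]

theorem spectralHom_apply (U : unitaryGroup N ℂ) (v : N → ℝ) :
    spectralHom U v =
      (U : Matrix N N ℂ) * diagonal (fun i => (v i : ℂ)) * star (U : Matrix N N ℂ) := rfl

theorem conjTranspose_spectralHom (U : unitaryGroup N ℂ) (v : N → ℝ) :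
    (spectralHom U v)ᴴ = spectralHom U v := by
  simp only [spectralHom_apply, conjTranspose_mul, star_eq_conjTranspose,
    conjTranspose_conjTranspose, diagonal_conjTranspose, mul_assoc]
  congr 3
  ext i
  simp

theorem spectralHom_eigenvalues {X : Matrix N N ℂ} (hX : X.IsHermitian) :
    spectralHom hX.eigenvectorUnitary hX.eigenvalues = X :=
  hX.spectral_theorem.symm

theorem mpow_eq_spectralHom_eigenvalues {X : Matrix N N ℂ} (hX : X.IsHermitian) (s : ℝ) :
    mpow X s = spectralHom hX.eigenvectorUnitary fun i => hX.eigenvalues i ^ s := by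
  rw [mpow, dif_pos hX, spectralHom_apply]

/-- Complex matrices as operators on Euclidean space, as a real algebra. -/
noncomputable def euclideanAlgEquiv (N : Type*) [Fintype N] [DecidableEq N] :
    Matrix N N ℂ ≃ₐ[ℝ] (EuclideanSpace ℂ N →L[ℂ] EuclideanSpace ℂ N) :=
  (toEuclideanCLM (n := N) (𝕜 := ℂ)).toAlgEquiv.restrictScalars ℝ

/-- `euclideanAlgEquiv` as a homeomorphic linear equivalence. -/
noncomputable def euclideanEquiv (N : Type*) [Fintype N] [DecidableEq N] :
    Matrix N N ℂ ≃L[ℝ] (EuclideanSpace ℂ N →L[ℂ] EuclideanSpace ℂ N) :=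
  (euclideanAlgEquiv N).toLinearEquiv.toContinuousLinearEquiv

theorem euclideanEquiv_mul (X Y : Matrix N N ℂ) :
    euclideanEquiv N (X * Y) = euclideanEquiv N X * euclideanEquiv N Y :=
  map_mul (euclideanAlgEquiv N) X Y

theorem euclideanEquiv_mpow {X : Matrix N N ℂ} (hX : X.PosDef) (s : ℝ) :
    euclideanEquiv N (mpow X s) =
      NormedSpace.exp (s • segmentLog (euclideanEquiv N X)) := by
  have h := exp_smul_segmentLog_map
    ((euclideanAlgEquiv N).toAlgHom.comp (spectralHom hX.1.eigenvectorUnitary)) hX.eigenvalues_pos s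
  have h1 : ((euclideanAlgEquiv N).toAlgHom.comp (spectralHom hX.1.eigenvectorUnitary))
      hX.1.eigenvalues = euclideanEquiv N X :=
    congrArg (euclideanEquiv N) (spectralHom_eigenvalues hX.1)
  rw [h1] at h
  rw [h, mpow_eq_spectralHom_eigenvalues hX.1]
  rfl

theorem mpow_spectralHom (U : unitaryGroup N ℂ) {d : N → ℝ} (hd : ∀ i, 0 < d i)
    (hX : (spectralHom U d).PosDef) (s : ℝ) :
    mpow (spectralHom U d) s = spectralHom U fun i => d i ^ s := by
  apply (euclideanEquiv N).injective
  rw [euclideanEquiv_mpow hX]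
  exact exp_smul_segmentLog_map ((euclideanAlgEquiv N).toAlgHom.comp (spectralHom U)) hd s

theorem mpow_smul {X : Matrix N N ℂ} (hX : X.PosDef) {c : ℝ} (hc : 0 < c) (s : ℝ) :
    mpow (c • X) s = c ^ s • mpow X s := by
  have h : c • X = spectralHom hX.1.eigenvectorUnitary (c • hX.1.eigenvalues) := by
    rw [map_smul, spectralHom_eigenvalues]
  have hcX : (c • X).PosDef := hX.smul hc
  rw [mpow_eq_spectralHom_eigenvalues hX.1, h, mpow_spectralHom, ← map_smul]
  · congr 1
    ext i
    simp [Real.mul_rpow hc.le (hX.eigenvalues_pos i).le]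
  · exact fun i => mul_pos hc (hX.eigenvalues_pos i)
  · rwa [← h]

theorem conjTranspose_mpow {X : Matrix N N ℂ} (hX : X.IsHermitian) (s : ℝ) :
    (mpow X s)ᴴ = mpow X s := by
  rw [mpow_eq_spectralHom_eigenvalues hX, conjTranspose_spectralHom]

theorem continuous_mpow {X : Matrix N N ℂ} (hX : X.PosDef) : Continuous (mpow X) := by
  have hexp : Continuous (NormedSpace.exp : (EuclideanSpace ℂ N →L[ℂ] EuclideanSpace ℂ N) → _) :=
    continuous_iff_continuousAt.2 fun x => (NormedSpace.exp_analytic (𝕂 := ℝ) x).continuousAt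
  have h : Continuous (fun s : ℝ => (euclideanEquiv N).symm
      (NormedSpace.exp (s • segmentLog (euclideanEquiv N X)))) :=
    (euclideanEquiv N).symm.continuous.comp
      (hexp.comp (continuous_id.smul continuous_const))
  convert h with s
  rw [← euclideanEquiv_mpow hX, ContinuousLinearEquiv.symm_apply_apply]

theorem continuous_sandwich_integrand {X : Matrix N N ℂ} (hX : X.PosDef) (α : ℝ)
    (C : Matrix N N ℂ) : Continuous fun s : ℝ =>
      Real.exp (α * (s - 1 / 2)) • (mpow X s * C * mpow X (1 - s)) := by
  have h1 := continuous_mpow hX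
  have h2 : Continuous fun s : ℝ => mpow X (1 - s) := h1.comp (by fun_prop)
  have h3 : Continuous fun s : ℝ => Real.exp (α * (s - 1 / 2)) := by fun_prop
  exact h3.smul ((h1.matrix_mul continuous_const).matrix_mul h2)

theorem sandwich_eq_integral {X : Matrix N N ℂ} (hX : X.PosDef) (α : ℝ) (C : Matrix N N ℂ) :
    sandwich X α C =
      ∫ s in (0 : ℝ)..1, Real.exp (α * (s - 1 / 2)) • (mpow X s * C * mpow X (1 - s)) := by
  ext i k
  let ev : Matrix N N ℂ →L[ℝ] ℂ := LinearMap.toContinuousLinearMap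
    ({ toFun := fun M => M i k, map_add' := fun _ _ => rfl, map_smul' := fun _ _ => rfl } :
      Matrix N N ℂ →ₗ[ℝ] ℂ)
  exact ev.intervalIntegral_comp_comm
    ((continuous_sandwich_integrand hX α C).intervalIntegrable 0 1)

theorem sandwich_eq_smoothSandwich {X : Matrix N N ℂ} (hX : X.PosDef) (α : ℝ)
    (C : Matrix N N ℂ) :
    sandwich X α C = (euclideanEquiv N).symm
      (smoothSandwich α (euclideanEquiv N C) (euclideanEquiv N X)) := by
  rw [ContinuousLinearEquiv.eq_symm_apply, sandwich_eq_integral hX]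
  refine ((euclideanEquiv N).toContinuousLinearMap.intervalIntegral_comp_comm
    ((continuous_sandwich_integrand hX α C).intervalIntegrable 0 1)).symm.trans ?_
  refine intervalIntegral.integral_congr fun s _ => ?_
  change euclideanEquiv N _ = _
  rw [map_smul, euclideanEquiv_mul, euclideanEquiv_mul, euclideanEquiv_mpow hX,
    euclideanEquiv_mpow hX]

theorem euclideanEquiv_mem_unitSegment {X : Matrix N N ℂ} (hX : X.PosDef) :
    euclideanEquiv N X ∈ unitSegment (EuclideanSpace ℂ N →L[ℂ] EuclideanSpace ℂ N) := by
  have h1 : ((euclideanAlgEquiv N).toAlgHom.comp (spectralHom hX.1.eigenvectorUnitary))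
      hX.1.eigenvalues = euclideanEquiv N X :=
    congrArg (euclideanEquiv N) (spectralHom_eigenvalues hX.1)
  rw [← h1]
  exact map_mem_unitSegment _ hX.eigenvalues_pos

theorem contDiffAt_smoothSandwich_comp {X : Matrix N N ℂ} (hX : X.PosDef) (α : ℝ)
    (C : Matrix N N ℂ) :
    ContDiffAt ℝ (⊤ : ℕ∞) (fun Y : Matrix N N ℂ => (euclideanEquiv N).symm
      (smoothSandwich α (euclideanEquiv N C) (euclideanEquiv N Y))) X := by
  have h := (contDiffOn_smoothSandwich α (euclideanEquiv N C)).contDiffAt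
    (isOpen_unitSegment.mem_nhds (euclideanEquiv_mem_unitSegment hX))
  exact (euclideanEquiv N).symm.contDiff.contDiffAt.comp X
    (h.comp X (euclideanEquiv N).contDiff.contDiffAt)

end Spectral

theorem posDef_mem_nhdsWithin {N : Type*} [Fintype N] {B : Matrix N N ℂ} (hB : B.PosDef) :
    {X : Matrix N N ℂ | X.PosDef} ∈ nhdsWithin B {X : Matrix N N ℂ | X.IsHermitian} := by
  have hev : ∀ᶠ X in nhds B, ∀ v ∈ Metric.sphere (0 : N → ℂ) 1, 0 < (star v ⬝ᵥ (X *ᵥ v)).re := by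
    refine (isCompact_sphere _ _).eventually_forall_of_forall_eventually fun v hv => ?_
    have hc : Continuous fun q : Matrix N N ℂ × (N → ℂ) => (star q.2 ⬝ᵥ (q.1 *ᵥ q.2)).re :=
      Complex.continuous_re.comp
        (continuous_snd.star.dotProduct (continuous_fst.matrix_mulVec continuous_snd))
    refine hc.continuousAt.eventually (lt_mem_nhds ?_)
    exact hB.re_dotProduct_pos (ne_zero_of_mem_unit_sphere ⟨v, hv⟩)
  filter_upwards [mem_nhdsWithin_of_mem_nhds hev, self_mem_nhdsWithin] with X hX hH
  refine PosDef.of_dotProduct_mulVec_pos hH fun v hv => ?_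
  have hn : 0 < ‖v‖ := norm_pos_iff.2 hv
  have h1 := hX ((‖v‖⁻¹ : ℂ) • v) (by simp [norm_smul, hn.ne'])
  have him : (star v ⬝ᵥ (X *ᵥ v)).im = 0 := hH.im_star_dotProduct_mulVec_self v
  rw [Complex.lt_def]
  refine ⟨?_, by simpa using him.symm⟩
  have h2 : star ((‖v‖⁻¹ : ℂ) • v) ⬝ᵥ (X *ᵥ ((‖v‖⁻¹ : ℂ) • v)) =
      ((‖v‖⁻¹ ^ 2 : ℝ) : ℂ) * (star v ⬝ᵥ (X *ᵥ v)) := by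
    simp [mulVec_smul, star_smul, smul_dotProduct, dotProduct_smul]
    ring
  rw [h2, Complex.re_ofReal_mul] at h1
  exact pos_of_mul_pos_right h1 (by positivity)

section Superadditivity

variable {N : Type*} [Fintype N] [DecidableEq N]

/-- The quadratic form `∑ᵢⱼ φ(λᵢ, λⱼ) |cᵢⱼ|²`, where `λᵢ` are the eigenvalues of `X` and `cᵢⱼ` the
entries of `C` in an eigenbasis of `X`. -/
noncomputable def spectralForm {X : Matrix N N ℂ} (hX : X.IsHermitian) (φ : ℝ → ℝ → ℝ)
    (C : Matrix N N ℂ) : ℝ :=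
  ∑ i, ∑ j, φ (hX.eigenvalues i) (hX.eigenvalues j) *
    Complex.normSq ((star (hX.eigenvectorUnitary : Matrix N N ℂ) * C * hX.eigenvectorUnitary) i j)

theorem trace_spectralHom (U : unitaryGroup N ℂ) (a b : N → ℝ) (C : Matrix N N ℂ) :
    (Cᴴ * (spectralHom U a * C * spectralHom U b)).trace.re =
      ∑ i, ∑ j, a i * b j *
        Complex.normSq ((star (U : Matrix N N ℂ) * C * (U : Matrix N N ℂ)) i j) := by
  set C' := star (U : Matrix N N ℂ) * C * (U : Matrix N N ℂ) with hC'
  have h1 : (Cᴴ * (spectralHom U a * C * spectralHom U b)).trace =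
      (C'ᴴ * (diagonal (fun i => (a i : ℂ)) * C' * diagonal (fun i => (b i : ℂ)))).trace := by
    simp only [spectralHom_apply, hC', star_eq_conjTranspose, conjTranspose_mul,
      conjTranspose_conjTranspose]
    rw [← mul_assoc, ← mul_assoc, ← mul_assoc, trace_mul_comm]
    simp only [mul_assoc]
  rw [h1, trace, Complex.re_sum, Finset.sum_comm]
  refine Finset.sum_congr rfl fun j _ => ?_
  rw [diag_apply, mul_apply, Complex.re_sum]
  refine Finset.sum_congr rfl fun i _ => ?_
  rw [mul_diagonal, diagonal_mul, conjTranspose_apply]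
  simp [Complex.normSq_apply]
  ring

theorem trace_mpow_mul_mpow {X : Matrix N N ℂ} (hX : X.IsHermitian) (s r : ℝ)
    (C : Matrix N N ℂ) :
    (Cᴴ * (mpow X s * C * mpow X r)).trace.re = spectralForm hX (fun x y => x ^ s * y ^ r) C := by
  rw [mpow_eq_spectralHom_eigenvalues hX, mpow_eq_spectralHom_eigenvalues hX, trace_spectralHom]
  rfl

theorem trace_mul_left {X : Matrix N N ℂ} (hX : X.IsHermitian) (C : Matrix N N ℂ) :
    (Cᴴ * (X * C)).trace.re = spectralForm hX (fun x _ => x) C := by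
  have h := trace_spectralHom hX.eigenvectorUnitary hX.eigenvalues 1 C
  rw [map_one, mul_one, spectralHom_eigenvalues hX] at h
  simpa [spectralForm] using h

theorem trace_mul_right {X : Matrix N N ℂ} (hX : X.IsHermitian) (C : Matrix N N ℂ) :
    (Cᴴ * (C * X)).trace.re = spectralForm hX (fun _ y => y) C := by
  have h := trace_spectralHom hX.eigenvectorUnitary 1 hX.eigenvalues C
  rw [map_one, one_mul, spectralHom_eigenvalues hX] at h
  simpa [spectralForm] using h

theorem normSq_add_mul_le {x y : ℝ} (hx : 0 < x) (hy : 0 < y) (p q : ℂ) :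
    x * y / (x + y) * Complex.normSq (p + q) ≤ x * Complex.normSq p + y * Complex.normSq q := by
  have h : 0 < x + y := add_pos hx hy
  rw [div_mul_eq_mul_div, div_le_iff₀ h]
  simp only [Complex.normSq_apply, Complex.add_re, Complex.add_im]
  nlinarith [sq_nonneg (x * p.re - y * q.re), sq_nonneg (x * p.im - y * q.im)]

theorem spectralForm_parallel_le {X : Matrix N N ℂ} (hX : X.PosDef) {t : ℝ} (ht : 0 < t)
    (P Q : Matrix N N ℂ) :
    spectralForm hX.1 (fun x y => x * (t * y) / (x + t * y)) (P + Q) ≤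
      (Pᴴ * (X * P)).trace.re + t * (Qᴴ * (Q * X)).trace.re := by
  rw [trace_mul_left hX.1, trace_mul_right hX.1]
  simp only [spectralForm, Finset.mul_sum, ← Finset.sum_add_distrib]
  refine Finset.sum_le_sum fun i _ => Finset.sum_le_sum fun j _ => ?_
  rw [mul_add, add_mul, Matrix.add_apply, ← mul_assoc t]
  exact normSq_add_mul_le (hX.eigenvalues_pos i) (mul_pos ht (hX.eigenvalues_pos j)) _ _

theorem exists_spectralForm_parallel_eq {X : Matrix N N ℂ} (hX : X.PosDef) {t : ℝ} (ht : 0 < t)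
    (C : Matrix N N ℂ) : ∃ P Q : Matrix N N ℂ, P + Q = C ∧
      spectralForm hX.1 (fun x y => x * (t * y) / (x + t * y)) C =
        (Pᴴ * (X * P)).trace.re + t * (Qᴴ * (Q * X)).trace.re := by
  set U : Matrix N N ℂ := (hX.1.eigenvectorUnitary : Matrix N N ℂ) with hU
  have hUU : star U * U = 1 := Unitary.coe_star_mul_self hX.1.eigenvectorUnitary
  have hUU' : U * star U = 1 := Unitary.coe_mul_star_self hX.1.eigenvectorUnitary
  set l := hX.1.eigenvalues with hl
  have hpos : ∀ i j, 0 < l i + t * l j := fun i j =>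
    add_pos (hX.eigenvalues_pos i) (mul_pos ht (hX.eigenvalues_pos j))
  let C' := star U * C * U
  let P' : Matrix N N ℂ := of fun i j => ((t * l j / (l i + t * l j) : ℝ) : ℂ) * C' i j
  let Q' : Matrix N N ℂ := of fun i j => ((l i / (l i + t * l j) : ℝ) : ℂ) * C' i j
  have hconj : ∀ M : Matrix N N ℂ, star U * (U * M * star U) * U = M := fun M => by
    calc _ = (star U * U) * M * (star U * U) := by simp only [mul_assoc]
      _ = M := by rw [hUU, one_mul, mul_one]
  have hsum : P' + Q' = C' := by
    ext i j
    have h1 : t * l j / (l i + t * l j) + l i / (l i + t * l j) = 1 := by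
      rw [← add_div, add_comm, div_self (hpos i j).ne']
    simp only [P', Q', Matrix.add_apply, of_apply, ← add_mul, ← Complex.ofReal_add, h1,
      Complex.ofReal_one, one_mul]
  refine ⟨U * P' * star U, U * Q' * star U, ?_, ?_⟩
  · rw [← add_mul, ← mul_add, hsum]
    calc _ = (U * star U) * C * (U * star U) := by simp only [C', mul_assoc]
      _ = C := by rw [hUU', one_mul, mul_one]
  · rw [trace_mul_left hX.1, trace_mul_right hX.1]
    simp only [spectralForm, Finset.mul_sum, ← Finset.sum_add_distrib, ← hU, ← hl, hconj]
    refine Finset.sum_congr rfl fun i _ => Finset.sum_congr rfl fun j _ => ?_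
    simp only [P', Q', of_apply, Complex.normSq_mul, Complex.normSq_ofReal]
    have := (hpos i j).ne'
    field_simp
    simp only [C']
    ring

theorem spectralForm_parallel_add_le {A B : Matrix N N ℂ} (hA : A.PosDef) (hB : B.PosDef)
    {t : ℝ} (ht : 0 < t) (C : Matrix N N ℂ) :
    spectralForm hA.1 (fun x y => x * (t * y) / (x + t * y)) C +
      spectralForm hB.1 (fun x y => x * (t * y) / (x + t * y)) C ≤
        spectralForm (hA.add hB).1 (fun x y => x * (t * y) / (x + t * y)) C := by
  obtain ⟨P, Q, rfl, h⟩ := exists_spectralForm_parallel_eq (hA.add hB) ht C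
  rw [h]
  have h1 := spectralForm_parallel_le hA ht P Q
  have h2 := spectralForm_parallel_le hB ht P Q
  simp only [add_mul, mul_add, trace_add, Complex.add_re]
  linarith

open Real in
theorem mul_rpowIntegrand₀₁_div {s t x y : ℝ} (hs : s ∈ Set.Ioo (0 : ℝ) 1) (ht : 0 < t)
    (hx : 0 < x) (hy : 0 < y) :
    y * rpowIntegrand₀₁ s t (x / y) = t ^ (s - 1) * t⁻¹ * (x * (t * y) / (x + t * y)) := by
  rw [rpowIntegrand₀₁_eq_pow_div hs ht.le (div_pos hx hy).le]
  have h1 : x + t * y ≠ 0 := by positivity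
  have h2 : t + x / y ≠ 0 := by positivity
  field_simp
  ring

open Real in
theorem spectralForm_rpow_eq_integral {X : Matrix N N ℂ} (hX : X.PosDef) {s : ℝ}
    (hs : s ∈ Set.Ioo (0 : ℝ) 1) (C : Matrix N N ℂ) :
    IntegrableOn (fun t => spectralForm hX.1 (fun x y => y * rpowIntegrand₀₁ s t (x / y)) C)
      (Set.Ioi 0) ∧
    spectralForm hX.1 (fun x y => x ^ s * y ^ (1 - s)) C =
      (∫ t in Set.Ioi 0, rpowIntegrand₀₁ s t 1)⁻¹ *
        ∫ t in Set.Ioi 0, spectralForm hX.1 (fun x y => y * rpowIntegrand₀₁ s t (x / y)) C := by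
  have hint : ∀ i j, IntegrableOn (fun t => hX.1.eigenvalues j *
      rpowIntegrand₀₁ s t (hX.1.eigenvalues i / hX.1.eigenvalues j) * Complex.normSq
        ((star (hX.1.eigenvectorUnitary : Matrix N N ℂ) * C * hX.1.eigenvectorUnitary) i j))
      (Set.Ioi 0) := fun i j =>
    ((integrableOn_rpowIntegrand₀₁_Ioi hs
      (div_pos (hX.eigenvalues_pos i) (hX.eigenvalues_pos j)).le).const_mul _).mul_const _
  refine ⟨integrable_finsetSum _ fun i _ => integrable_finsetSum _ fun j _ => hint i j, ?_⟩
  simp only [spectralForm]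
  rw [integral_finsetSum _ fun i _ => integrable_finsetSum _ fun j _ => hint i j, Finset.mul_sum]
  refine Finset.sum_congr rfl fun i _ => ?_
  rw [integral_finsetSum _ fun j _ => hint i j, Finset.mul_sum]
  refine Finset.sum_congr rfl fun j _ => ?_
  have hi := hX.eigenvalues_pos i
  have hj := hX.eigenvalues_pos j
  rw [integral_mul_const, integral_const_mul, ← mul_assoc, mul_left_comm,
    ← rpow_eq_const_mul_integral hs (div_pos hi hj).le, Real.div_rpow hi.le hj.le,
    Real.rpow_sub hj, Real.rpow_one]
  ring

/-- Lieb's concavity theorem for `X ↦ Tr(C* X^s C X^{1-s})`, as superadditivity. -/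
theorem spectralForm_rpow_add_le {A B : Matrix N N ℂ} (hA : A.PosDef) (hB : B.PosDef)
    {s : ℝ} (hs : s ∈ Set.Ioo (0 : ℝ) 1) (C : Matrix N N ℂ) :
    spectralForm hA.1 (fun x y => x ^ s * y ^ (1 - s)) C +
      spectralForm hB.1 (fun x y => x ^ s * y ^ (1 - s)) C ≤
        spectralForm (hA.add hB).1 (fun x y => x ^ s * y ^ (1 - s)) C := by
  obtain ⟨iA, eA⟩ := spectralForm_rpow_eq_integral hA hs C
  obtain ⟨iB, eB⟩ := spectralForm_rpow_eq_integral hB hs C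
  obtain ⟨iM, eM⟩ := spectralForm_rpow_eq_integral (hA.add hB) hs C
  rw [eA, eB, eM, ← mul_add, ← integral_add iA iB]
  refine mul_le_mul_of_nonneg_left ?_ (inv_nonneg.2 (Real.integral_rpowIntegrand₀₁_one_pos hs).le)
  refine setIntegral_mono_on (iA.add iB) iM measurableSet_Ioi fun t ht => ?_
  have key : ∀ {X : Matrix N N ℂ} (hX : X.PosDef),
      spectralForm hX.1 (fun x y => y * Real.rpowIntegrand₀₁ s t (x / y)) C =
        t ^ (s - 1) * t⁻¹ * spectralForm hX.1 (fun x y => x * (t * y) / (x + t * y)) C := by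
    intro X hX
    simp only [spectralForm, Finset.mul_sum]
    refine Finset.sum_congr rfl fun i _ => Finset.sum_congr rfl fun j _ => ?_
    rw [mul_rpowIntegrand₀₁_div hs ht (hX.eigenvalues_pos i) (hX.eigenvalues_pos j), mul_assoc]
  rw [key hA, key hB, key (hA.add hB), ← mul_add]
  have ht' : (0 : ℝ) < t := ht
  exact mul_le_mul_of_nonneg_left (spectralForm_parallel_add_le hA hB ht C) (by positivity)

end Superadditivity

section Gns

theorem gns_conj_symm {N : Type*} [Fintype N] (A B : Matrix N N ℂ) : star (gns A B) = gns B A := by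
  have h : Bᴴ * A = (Aᴴ * B)ᴴ := by simp
  rw [gns, gns, h, tau, tau, trace_conjTranspose]
  simp

variable {N : Type*} [Fintype N] [DecidableEq N]

/-- The real linear form `gns C`. -/
noncomputable def gnsCLM (C : Matrix N N ℂ) : Matrix N N ℂ →L[ℝ] ℂ :=
  LinearMap.toContinuousLinearMap
    { toFun := gns C
      map_add' := fun A B => by simp [gns, tau, mul_add, add_div]
      map_smul' := fun r A => by simp [gns, tau, mul_div_assoc] }

theorem gnsCLM_apply (C A : Matrix N N ℂ) : gnsCLM C A = gns C A := rfl

theorem continuous_gns_sandwich_integrand {X : Matrix N N ℂ} (hX : X.PosDef) (α : ℝ)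
    (C E : Matrix N N ℂ) : Continuous fun s : ℝ =>
      Real.exp (α * (s - 1 / 2)) • gns C (mpow X s * E * mpow X (1 - s)) := by
  have := (gnsCLM C).continuous.comp (continuous_sandwich_integrand hX α E)
  simpa only [Function.comp_def, map_smul, gnsCLM_apply] using this

theorem gns_sandwich {X : Matrix N N ℂ} (hX : X.PosDef) (α : ℝ) (C E : Matrix N N ℂ) :
    gns C (sandwich X α E) = ∫ s in (0 : ℝ)..1,
      Real.exp (α * (s - 1 / 2)) • gns C (mpow X s * E * mpow X (1 - s)) := by
  rw [sandwich_eq_integral hX, ← gnsCLM_apply]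
  refine ((gnsCLM C).intervalIntegral_comp_comm
    ((continuous_sandwich_integrand hX α E).intervalIntegrable 0 1)).symm.trans ?_
  exact intervalIntegral.integral_congr fun s _ => map_smul (gnsCLM C) _ _

theorem gns_sandwich_comm {X : Matrix N N ℂ} (hX : X.PosDef) (α : ℝ) (C E : Matrix N N ℂ) :
    gns (sandwich X α C) E = gns C (sandwich X α E) := by
  rw [← gns_conj_symm, gns_sandwich hX, gns_sandwich hX]
  refine (Complex.conjCLE.toContinuousLinearMap.intervalIntegral_comp_comm
    ((continuous_gns_sandwich_integrand hX α E C).intervalIntegrable 0 1)).symm.trans ?_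
  refine intervalIntegral.integral_congr fun s _ => ?_
  have h : star (gns E (mpow X s * C * mpow X (1 - s))) =
      gns C (mpow X s * E * mpow X (1 - s)) := by
    rw [gns_conj_symm]
    simp only [gns, conjTranspose_mul, conjTranspose_mpow hX.1]
    rw [mul_assoc, tau, trace_mul_comm, tau]
    simp only [mul_assoc]
  change star _ = _
  rw [← h, star_smul, star_trivial]

theorem gns_sandwich_re {X : Matrix N N ℂ} (hX : X.PosDef) (α : ℝ) (C : Matrix N N ℂ) :
    (gns C (sandwich X α C)).re = ∫ s in (0 : ℝ)..1, Real.exp (α * (s - 1 / 2)) *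
      (spectralForm hX.1 (fun x y => x ^ s * y ^ (1 - s)) C / Fintype.card N) := by
  rw [gns_sandwich hX]
  refine (Complex.reCLM.intervalIntegral_comp_comm
    ((continuous_gns_sandwich_integrand hX α C C).intervalIntegrable 0 1)).symm.trans ?_
  refine intervalIntegral.integral_congr fun s _ => ?_
  simp only [Complex.reCLM_apply, Complex.real_smul, Complex.re_ofReal_mul]
  rw [gns, tau, Complex.div_natCast_re, trace_mpow_mul_mpow hX.1]

theorem continuous_spectralForm_rpow {X : Matrix N N ℂ} (hX : X.PosDef) (α : ℝ)
    (C : Matrix N N ℂ) : Continuous fun s : ℝ => Real.exp (α * (s - 1 / 2)) *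
      (spectralForm hX.1 (fun x y => x ^ s * y ^ (1 - s)) C / Fintype.card N) := by
  have h : Continuous fun s : ℝ => spectralForm hX.1 (fun x y => x ^ s * y ^ (1 - s)) C := by
    refine continuous_finsetSum _ fun i _ => continuous_finsetSum _ fun j _ => ?_
    have h1 : Continuous fun s : ℝ => hX.1.eigenvalues i ^ s :=
      Real.continuous_const_rpow (hX.eigenvalues_pos i).ne'
    have h2 : Continuous fun s : ℝ => hX.1.eigenvalues j ^ (1 - s) :=
      (Real.continuous_const_rpow (hX.eigenvalues_pos j).ne').comp (by fun_prop)
    exact (h1.mul h2).mul continuous_const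
  have h3 : Continuous fun s : ℝ => Real.exp (α * (s - 1 / 2)) := by fun_prop
  exact h3.mul (h.div_const _)

theorem gns_sandwich_add_le {A B : Matrix N N ℂ} (hA : A.PosDef) (hB : B.PosDef) (α : ℝ)
    (C : Matrix N N ℂ) :
    (gns C (sandwich A α C)).re + (gns C (sandwich B α C)).re ≤
      (gns C (sandwich (A + B) α C)).re := by
  have cA := continuous_spectralForm_rpow hA α C
  have cB := continuous_spectralForm_rpow hB α C
  have cM := continuous_spectralForm_rpow (hA.add hB) α C
  rw [gns_sandwich_re hA, gns_sandwich_re hB, gns_sandwich_re (hA.add hB),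
    ← intervalIntegral.integral_add (cA.intervalIntegrable _ _) (cB.intervalIntegrable _ _)]
  refine intervalIntegral.integral_mono_on_of_le_Ioo zero_le_one
    ((cA.add cB).intervalIntegrable _ _) (cM.intervalIntegrable _ _) fun s hs => ?_
  rw [← mul_add, ← add_div]
  gcongr
  exact spectralForm_rpow_add_le hA hB hs C

theorem sandwich_smul {X : Matrix N N ℂ} (hX : X.PosDef) {c : ℝ} (hc : 0 < c) (α : ℝ)
    (C : Matrix N N ℂ) : sandwich (c • X) α C = c • sandwich X α C := by
  have hcX : (c • X).PosDef := hX.smul hc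
  rw [sandwich_eq_integral hX, sandwich_eq_integral hcX, ← intervalIntegral.integral_smul]
  refine intervalIntegral.integral_congr fun s _ => ?_
  have h : c ^ s * c ^ (1 - s) = c := by
    rw [← Real.rpow_add hc, add_sub_cancel, Real.rpow_one]
  simp only [mpow_smul hX hc, smul_mul_assoc, mul_smul_comm, smul_smul]
  congr 1
  linear_combination Real.exp (α * (s - 1 / 2)) * h

theorem tendsto_sandwich_slope {A B : Matrix N N ℂ} (hA : A.IsHermitian) (hB : B.IsHermitian)
    {α : ℝ} {C : Matrix N N ℂ} {D : Matrix N N ℂ →L[ℝ] Matrix N N ℂ}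
    (hD : HasFDerivWithinAt (fun X => sandwich X α C) D {X : Matrix N N ℂ | X.IsHermitian} B) :
    Filter.Tendsto (fun r : ℝ => r⁻¹ • (sandwich (B + r • A) α C - sandwich B α C))
      (nhdsWithin 0 (Set.Ioi 0)) (nhds (D A)) := by
  have hline : HasDerivWithinAt (fun r : ℝ => B + r • A) A Set.univ 0 := by
    have h := ((hasDerivAt_id (0 : ℝ)).smul_const A).const_add B
    rw [one_smul] at h
    exact h.hasDerivWithinAt
  have hD' : HasFDerivWithinAt (fun X => sandwich X α C) D {X : Matrix N N ℂ | X.IsHermitian}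
      (B + (0 : ℝ) • A) := by simpa using hD
  have hmaps : Set.MapsTo (fun r : ℝ => B + r • A) Set.univ
      {X : Matrix N N ℂ | X.IsHermitian} := fun r _ =>
    hB.add (hA.smul (IsSelfAdjoint.all r))
  have h := (hD'.comp_hasDerivWithinAt (0 : ℝ) hline hmaps).hasDerivAt Filter.univ_mem
  have h' := (hasDerivAt_iff_tendsto_slope_zero.1 h).mono_left
    (nhdsWithin_mono 0 fun r (hr : r ∈ Set.Ioi 0) => ne_of_gt hr)
  simp only [Function.comp_apply, zero_add, zero_smul, add_zero] at h'
  exact h'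

end Gns

/-- **Smoothness and derivative bound for `f(X) = [X]_α`** (Lemma 3.3).  The map
`f : X ↦ [X]_α` is infinitely (Fréchet) differentiable on the positive definite matrices
(within the real subspace of hermitian matrices), and for positive definite `A, B`, any
Fréchet derivative `D` of `f` at `B` (within the hermitian matrices) satisfies
`Df(B)[A] ≥ f(A)` in the Loewner order on operators on `(M_n(ℂ), ⟨·,·⟩)`, with
`Df(A)[A] = f(A)`.  (Here `D C` is the derivative of `X ↦ [X]_α C`, so that
`Df(B)[A] : C ↦ D C A`.) -/
theorem sandwich_contDiff_deriv_ge {N : Type*} [Fintype N] [DecidableEq N] (α : ℝ) :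
    (∀ C : Matrix N N ℂ, ContDiffOn ℝ (⊤ : ℕ∞) (fun X => sandwich X α C)
      {X : Matrix N N ℂ | X.PosDef}) ∧
    (∀ B : Matrix N N ℂ, B.PosDef →
      ∃ D : Matrix N N ℂ → (Matrix N N ℂ →L[ℝ] Matrix N N ℂ),
        ∀ C, HasFDerivWithinAt (fun X => sandwich X α C) (D C)
          {X : Matrix N N ℂ | X.IsHermitian} B) ∧
    (∀ A B : Matrix N N ℂ, A.PosDef → B.PosDef →
      ∀ D : Matrix N N ℂ → (Matrix N N ℂ →L[ℝ] Matrix N N ℂ),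
        (∀ C, HasFDerivWithinAt (fun X => sandwich X α C) (D C)
          {X : Matrix N N ℂ | X.IsHermitian} B) →
        OpPosSemidef (fun C => D C A - sandwich A α C)) ∧
    (∀ A : Matrix N N ℂ, A.PosDef →
      ∀ D : Matrix N N ℂ → (Matrix N N ℂ →L[ℝ] Matrix N N ℂ),
        (∀ C, HasFDerivWithinAt (fun X => sandwich X α C) (D C)
          {X : Matrix N N ℂ | X.IsHermitian} A) →
        ∀ C, D C A = sandwich A α C) := by
  have hasDeriv : ∀ {B : Matrix N N ℂ}, B.PosDef → ∀ C, ∃ D : Matrix N N ℂ →L[ℝ] Matrix N N ℂ,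
      HasFDerivWithinAt (fun X => sandwich X α C) D {X : Matrix N N ℂ | X.IsHermitian} B := by
    intro B hB C
    have h := ((contDiffAt_smoothSandwich_comp hB α C).differentiableAt
      (by simp)).hasFDerivAt.hasFDerivWithinAt (s := {X : Matrix N N ℂ | X.IsHermitian})
    refine ⟨_, h.congr_of_eventuallyEq ?_ (sandwich_eq_smoothSandwich hB α C)⟩
    filter_upwards [posDef_mem_nhdsWithin hB] with X hX
    exact sandwich_eq_smoothSandwich hX α C
  refine ⟨fun C => ?_, fun B hB => ?_, fun A B hA hB D hD => ⟨fun C E => ?_, fun C => ?_⟩,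
    fun A hA D hD C => ?_⟩
  · have h : ContDiffOn ℝ (⊤ : ℕ∞) (fun Y : Matrix N N ℂ => (euclideanEquiv N).symm
        (smoothSandwich α (euclideanEquiv N C) (euclideanEquiv N Y))) {X | X.PosDef} :=
      fun X hX => (contDiffAt_smoothSandwich_comp hX α C).contDiffWithinAt
    exact h.congr fun X hX => sandwich_eq_smoothSandwich hX α C
  · exact ⟨fun C => (hasDeriv hB C).choose, fun C => (hasDeriv hB C).choose_spec⟩
  · have hslope : ∀ r ∈ Set.Ioi (0 : ℝ),
        gns E (r⁻¹ • (sandwich (B + r • A) α C - sandwich B α C)) =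
          star (gns C (r⁻¹ • (sandwich (B + r • A) α E - sandwich B α E))) := by
      intro r hr
      have hM : (B + r • A).PosDef := hB.add (hA.smul hr)
      simp only [← gnsCLM_apply, map_smul, map_sub]
      simp only [gnsCLM_apply, ← gns_sandwich_comm hM α C E, ← gns_sandwich_comm hB α C E]
      rw [← gns_conj_symm _ E, ← gns_conj_symm _ E]
      simp
    have h1 := ((gnsCLM E).continuous.tendsto _).comp (tendsto_sandwich_slope hA.1 hB.1 (hD C))
    have h2 := (continuous_star.tendsto _).comp (((gnsCLM C).continuous.tendsto _).comp
      (tendsto_sandwich_slope hA.1 hB.1 (hD E)))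
    have h3 : gns E (D C A) = star (gns C (D E A)) := by
      refine tendsto_nhds_unique h1 (h2.congr' ?_)
      filter_upwards [self_mem_nhdsWithin] with r hr
      exact (hslope r hr).symm
    have h4 : gns E (D C A - sandwich A α C) = star (gns C (D E A - sandwich A α E)) := by
      simp only [← gnsCLM_apply, map_sub, star_sub]
      simp only [gnsCLM_apply, h3, ← gns_sandwich_comm hA α C E, gns_conj_symm]
    rw [← gns_conj_symm, h4, star_star]
  · have h1 := (Complex.continuous_re.tendsto _).comp (((gnsCLM C).continuous.tendsto _).comp
      ((tendsto_sandwich_slope hA.1 hB.1 (hD C)).sub_const (sandwich A α C)))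
    refine ge_of_tendsto h1 ?_
    filter_upwards [self_mem_nhdsWithin] with r hr
    have hr' : 0 < r := hr
    have h := gns_sandwich_add_le hB (hA.smul hr' : (r • A).PosDef) α C
    rw [sandwich_smul hA hr', ← gnsCLM_apply, ← gnsCLM_apply, ← gnsCLM_apply, map_smul,
      Complex.smul_re, smul_eq_mul] at h
    simp only [Function.comp_apply, map_sub, map_smul, Complex.sub_re, Complex.smul_re, smul_eq_mul]
    rw [sub_nonneg, inv_mul_eq_div, le_div_iff₀ hr']
    linarith
  · refine tendsto_nhds_unique (tendsto_sandwich_slope hA.1 hA.1 (hD C)) ?_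
    refine tendsto_const_nhds.congr' ?_
    filter_upwards [self_mem_nhdsWithin] with r hr
    have hr' : 0 < r := hr
    have h : A + r • A = (1 + r) • A := by rw [add_smul, one_smul]
    rw [h, sandwich_smul hA (by linarith), add_smul, one_smul, add_sub_cancel_left, smul_smul,
      inv_mul_cancel₀ hr'.ne', one_smul]
end
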